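/- arXiv:2406.13943 — 2 statements merged into one kernel-verified Lean document; each statement's English description precedes it below -/
import Mathlib

section
/- Let p be an odd prime, q = p^m with q = 2^a·b + 1, b odd, a ≥ 2, let r ≥ 2, and N = 2^r·p^s. Let C be the ideal of R = F_q[x]/(x^N − 1) generated by m_0(x)^{j_0} · m_{2^{r−1}}(x)^{j_{2^{r−1}}} · ∏_{i=2}^r ∏_{s ∈ D_i} m_{2^{r−i}s}(x)^{j_{2^{r−i}s}}, where 0 ≤ j_t ≤ p^s for each t ∈ T_n. Then C^⊥ ⊆ C if and only if 2·j_0 < p^s, 2·j_{2^{r−1}} < p^s, and j_{2^{r−i}s} + j_{2^{r−i}(−s)} ≤ p^s for every s ∈ D_i and every 2 ≤ i ≤ r. -/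
open Polynomial

/-- The coefficient vector (with respect to the basis `1, x, …, x^{deg f − 1}` of
`F[x]/(f)`) of an element of `F[x]/(f)`. -/
noncomputable def coeffRepr {F : Type*} [Field F] {f : Polynomial F} (hf : f ≠ 0)
    (x : AdjoinRoot f) (i : Fin (AdjoinRoot.powerBasis hf).dim) : F :=
  (AdjoinRoot.powerBasis hf).basis.repr x i

/-- The (Euclidean) dual code of a cyclic code `C ⊆ F[x]/(f)`. -/
noncomputable def dualCode {F : Type*} [Field F] {f : Polynomial F} (hf : f ≠ 0)
    (C : Ideal (AdjoinRoot f)) : Set (AdjoinRoot f) :=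
  {x | ∀ y ∈ C, ∑ i, coeffRepr hf x i * coeffRepr hf y i = 0}

/-- The set `D_i` (for `q = 2^a·b + 1`). -/
def Dfin (a i : ℕ) : Finset ℤ :=
  if i ≤ a then
    ((Finset.range (2 ^ (i - 2))).image fun v => (3 : ℤ) ^ v) ∪
      ((Finset.range (2 ^ (i - 2))).image fun v => -(3 : ℤ) ^ v)
  else
    ((Finset.range (2 ^ (a - 2))).image fun v => (3 : ℤ) ^ v) ∪
      ((Finset.range (2 ^ (a - 2))).image fun v => -(3 : ℤ) ^ v)

section Dual

variable {F : Type*} [Field F]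

lemma AdjoinRoot.root_pow_X_pow_sub_one (N : ℕ) :
    (AdjoinRoot.root (X ^ N - 1 : F[X])) ^ N = 1 := by
  rw [← sub_eq_zero, ← AdjoinRoot.mk_X, ← map_pow, ← map_one (AdjoinRoot.mk (X ^ N - 1 : F[X])),
    ← map_sub, AdjoinRoot.mk_self]

lemma eval_root_X_pow_sub_one (N : ℕ) (x : AdjoinRoot (X ^ N - 1 : F[X])) (hx : x ^ N = 1) :
    (X ^ N - 1 : F[X]).eval₂ (algebraMap F (AdjoinRoot (X ^ N - 1 : F[X]))) x = 0 := by
  simp [hx]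

/-- The involution `x ↦ x⁻¹` of `F[x]/(x ^ N - 1)`. -/
noncomputable def cyclicInv (N : ℕ) :
    AdjoinRoot (X ^ N - 1 : F[X]) →ₐ[F] AdjoinRoot (X ^ N - 1 : F[X]) :=
  AdjoinRoot.liftAlgHom _ (Algebra.ofId F _) (AdjoinRoot.root (X ^ N - 1 : F[X]) ^ (N - 1))
    (eval_root_X_pow_sub_one N _ (by
      rw [← pow_mul, mul_comm, pow_mul, AdjoinRoot.root_pow_X_pow_sub_one, one_pow]))

lemma cyclicInv_root (N : ℕ) :
    cyclicInv N (AdjoinRoot.root (X ^ N - 1 : F[X])) =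
      AdjoinRoot.root (X ^ N - 1 : F[X]) ^ (N - 1) := by
  exact AdjoinRoot.liftAlgHom_root ..

lemma root_mul_cyclicInv_root {N : ℕ} (hN : 0 < N) :
    AdjoinRoot.root (X ^ N - 1 : F[X]) * cyclicInv N (AdjoinRoot.root (X ^ N - 1 : F[X])) = 1 := by
  rw [cyclicInv_root, mul_pow_sub_one hN.ne', AdjoinRoot.root_pow_X_pow_sub_one]

/-- The involution sends the class of `g` to that of its reverse, up to a unit. -/
lemma cyclicInv_mk_mul {N : ℕ} (hN : 0 < N) (g : F[X]) :
    cyclicInv N (AdjoinRoot.mk _ g) * AdjoinRoot.root (X ^ N - 1 : F[X]) ^ g.natDegree =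
      AdjoinRoot.mk _ g.reverse := by
  set ρ := AdjoinRoot.root (X ^ N - 1 : F[X])
  have hρ : ρ * cyclicInv N ρ = 1 := root_mul_cyclicInv_root hN
  let _ : Invertible (cyclicInv N ρ) := ⟨ρ, hρ, by rw [mul_comm, hρ]⟩
  have h := eval₂_reverse_mul_pow (algebraMap F (AdjoinRoot (X ^ N - 1 : F[X])))
    (cyclicInv N ρ) g
  have h1 : cyclicInv N (AdjoinRoot.mk _ g) =
      g.eval₂ (algebraMap F (AdjoinRoot (X ^ N - 1 : F[X]))) (cyclicInv N ρ) := by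
    rw [← AdjoinRoot.aeval_eq, ← aeval_algHom_apply, aeval_def]
  have h2 : AdjoinRoot.mk (X ^ N - 1 : F[X]) g.reverse =
      g.reverse.eval₂ (algebraMap F (AdjoinRoot (X ^ N - 1 : F[X]))) ρ := by
    rw [← AdjoinRoot.aeval_eq, aeval_def]
  have h3 : ⅟(cyclicInv N ρ) = ρ := rfl
  rw [h3] at h
  rw [h1, h2, ← h, mul_assoc, ← mul_pow, mul_comm (cyclicInv N ρ), hρ, one_pow, mul_one]

lemma natDegree_X_pow_sub_one_field (N : ℕ) : (X ^ N - 1 : F[X]).natDegree = N := by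
  simpa using natDegree_X_pow_sub_C (n := N) (r := (1 : F))

/-- The coordinates of a power of the root. -/
lemma coeffRepr_root_pow {N : ℕ} (hf : (X ^ N - 1 : F[X]) ≠ 0)
    (k i : Fin (AdjoinRoot.powerBasis hf).dim) :
    coeffRepr hf (AdjoinRoot.root (X ^ N - 1 : F[X]) ^ (k : ℕ)) i = if k = i then 1 else 0 := by
  have h := (AdjoinRoot.powerBasis hf).basis_eq_pow k
  rw [AdjoinRoot.powerBasis_gen] at h
  rw [coeffRepr, ← h, Module.Basis.repr_self, Finsupp.single_apply]

lemma powerBasis_dim_X_pow_sub_one {N : ℕ} (hf : (X ^ N - 1 : F[X]) ≠ 0) :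
    (AdjoinRoot.powerBasis hf).dim = N := by
  rw [AdjoinRoot.powerBasis_dim, natDegree_X_pow_sub_one_field]

lemma eq_sum_coeffRepr {f : F[X]} (hf : f ≠ 0) (x : AdjoinRoot f) :
    x = ∑ i, coeffRepr hf x i • AdjoinRoot.root f ^ (i : ℕ) := by
  conv_lhs => rw [← (AdjoinRoot.powerBasis hf).basis.sum_repr x]
  simp [coeffRepr, PowerBasis.basis_eq_pow]

/-- The inner product of `x` and `y` is the constant coefficient of `x(ξ) y(ξ⁻¹)`. -/
lemma sum_coeffRepr_mul {N : ℕ} (hN : 0 < N) (hf : (X ^ N - 1 : F[X]) ≠ 0)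
    (x y : AdjoinRoot (X ^ N - 1 : F[X])) :
    ∑ i, coeffRepr hf x i * coeffRepr hf y i =
      coeffRepr hf (x * cyclicInv N y) ⟨0, by rwa [powerBasis_dim_X_pow_sub_one]⟩ := by
  set ρ := AdjoinRoot.root (X ^ N - 1 : F[X])
  have hρ : ρ * cyclicInv N ρ = 1 := root_mul_cyclicInv_root hN
  have hd := powerBasis_dim_X_pow_sub_one hf
  set z : Fin (AdjoinRoot.powerBasis hf).dim := ⟨0, by rwa [powerBasis_dim_X_pow_sub_one]⟩ with hz
  have hρk : ∀ k l : ℕ, ρ ^ (k + l) * cyclicInv N ρ ^ l = ρ ^ k := fun k l ↦ by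
    rw [pow_add, mul_assoc, ← mul_pow, hρ, one_pow, mul_one]
  have hpow : ∀ k < N, coeffRepr hf (ρ ^ k) z = if k = 0 then 1 else 0 := fun k hk ↦ by
    rw [show k = ((⟨k, by omega⟩ : Fin (AdjoinRoot.powerBasis hf).dim) : ℕ) from rfl,
      coeffRepr_root_pow]
    simp [hz, Fin.ext_iff]
  have key : ∀ i k : Fin (AdjoinRoot.powerBasis hf).dim,
      coeffRepr hf (ρ ^ (i : ℕ) * cyclicInv N ρ ^ (k : ℕ)) z = if i = k then 1 else 0 := by
    intro i k
    have hi := i.2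
    have hk := k.2
    rcases le_total (k : ℕ) i with h | h
    · obtain ⟨d, hd'⟩ := Nat.exists_eq_add_of_le h
      rw [hd', add_comm, hρk, hpow d (by omega)]
      simp only [Fin.ext_iff]
      congr 1
      simp only [eq_iff_iff]; omega
    · have h1 : ρ ^ (i : ℕ) * cyclicInv N ρ ^ (k : ℕ) = ρ ^ ((N + i) - k : ℕ) := by
        rw [← hρk (N + i - k) k, Nat.sub_add_cancel (by omega), pow_add,
          AdjoinRoot.root_pow_X_pow_sub_one, one_mul]
      rw [h1]
      by_cases hik : i = k
      · subst hik
        rw [Nat.add_sub_cancel, AdjoinRoot.root_pow_X_pow_sub_one, ← pow_zero ρ, hpow 0 hN]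
        simp
      · have : (i : ℕ) ≠ k := fun h ↦ hik (Fin.ext h)
        rw [hpow _ (by omega), if_neg (by omega), if_neg hik]
  have hx := eq_sum_coeffRepr hf x
  have hy := congrArg (cyclicInv N) (eq_sum_coeffRepr hf y)
  rw [map_sum] at hy
  have hlin : ∀ w, coeffRepr hf w z =
      ((AdjoinRoot.powerBasis hf).basis.coord z) w := fun w ↦ rfl
  conv_rhs => rw [hlin, hx, hy, Finset.sum_mul_sum]
  simp only [map_sum, map_smul, map_pow, smul_mul_smul_comm, smul_eq_mul]
  simp only [← hlin]
  simp_rw [show ∀ i k : Fin (AdjoinRoot.powerBasis hf).dim,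
    coeffRepr hf (AdjoinRoot.root (X ^ N - 1 : F[X]) ^ (i : ℕ) *
      cyclicInv N (AdjoinRoot.root (X ^ N - 1 : F[X])) ^ (k : ℕ)) z = if i = k then 1 else 0
    from key]
  simp

/-- The dual of the cyclic code generated by `g` is the annihilator of the reverse of `g`. -/
lemma mem_dualCode_span_iff {N : ℕ} (hN : 0 < N) (hf : (X ^ N - 1 : F[X]) ≠ 0) (g : F[X])
    (x : AdjoinRoot (X ^ N - 1 : F[X])) :
    x ∈ dualCode hf (Ideal.span {AdjoinRoot.mk _ g}) ↔
      x * AdjoinRoot.mk _ g.reverse = 0 := by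
  have hu : IsUnit (AdjoinRoot.root (X ^ N - 1 : F[X]) ^ g.natDegree) :=
    (IsUnit.of_mul_eq_one _ (root_mul_cyclicInv_root hN)).pow _
  rw [← cyclicInv_mk_mul hN, ← mul_assoc, hu.mul_left_eq_zero]
  simp only [dualCode, Set.mem_ofPred_eq]
  constructor
  · intro h
    rw [eq_sum_coeffRepr hf (x * cyclicInv N (AdjoinRoot.mk _ g))]
    refine Finset.sum_eq_zero fun i _ ↦ ?_
    have h1 := h (AdjoinRoot.root (X ^ N - 1 : F[X]) ^ (i : ℕ) * AdjoinRoot.mk _ g)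
      (Ideal.mul_mem_left _ _ (Ideal.mem_span_singleton_self _))
    rw [sum_coeffRepr_mul hN, map_mul, mul_left_comm, mul_comm, ← sum_coeffRepr_mul hN] at h1
    simp only [coeffRepr_root_pow] at h1
    rw [show coeffRepr hf (x * cyclicInv N (AdjoinRoot.mk _ g)) i = 0 by simpa using h1, zero_smul]
  · intro h y hy
    obtain ⟨w, rfl⟩ := Ideal.mem_span_singleton'.mp hy
    rw [sum_coeffRepr_mul hN, map_mul, mul_left_comm, h, mul_zero]
    simp [coeffRepr]

/-- A cyclic code of length `N` with generator polynomial `g` contains its dual if and only if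
the product of `g` and its reverse divides `X ^ N - 1`. -/
lemma dualCode_span_subset_iff {N : ℕ} (hN : 0 < N) (hf : (X ^ N - 1 : F[X]) ≠ 0) {g : F[X]}
    (hg : g ∣ X ^ N - 1) (hg' : g.reverse ∣ X ^ N - 1) :
    dualCode hf (Ideal.span {AdjoinRoot.mk _ g}) ⊆ ↑(Ideal.span {AdjoinRoot.mk (X ^ N - 1) g}) ↔
      g.reverse * g ∣ X ^ N - 1 := by
  have h0 : g.reverse ≠ 0 := fun h ↦ hf (by simpa [h] using hg')
  constructor
  · intro h
    obtain ⟨l, hl⟩ := hg'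
    have h1 : AdjoinRoot.mk (X ^ N - 1) l ∈ dualCode hf (Ideal.span {AdjoinRoot.mk _ g}) := by
      rw [mem_dualCode_span_iff hN, ← map_mul, AdjoinRoot.mk_eq_zero, mul_comm, ← hl]
    obtain ⟨w, hw⟩ := Ideal.mem_span_singleton'.mp (h h1)
    obtain ⟨w, rfl⟩ := AdjoinRoot.mk_surjective w
    rw [← map_mul, AdjoinRoot.mk_eq_mk] at hw
    have h2 : g ∣ l := (dvd_sub_right (Dvd.intro_left w rfl)).mp (hg.trans hw)
    exact hl ▸ mul_dvd_mul_left _ h2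
  · rintro h x hx
    obtain ⟨y, rfl⟩ := AdjoinRoot.mk_surjective x
    rw [mem_dualCode_span_iff hN, ← map_mul, AdjoinRoot.mk_eq_zero, mul_comm] at hx
    exact Ideal.mem_span_singleton.mpr
      (map_dvd _ ((mul_dvd_mul_iff_left h0).mp (h.trans hx)))

end Dual

section Factors

variable {F : Type*} [Field F]

/-- Divisibility of a power of a squarefree polynomial by a product of powers of distinct monic
irreducible factors is decided exponent by exponent. -/
lemma prod_pow_dvd_pow_iff {κ : Type*} {K : Finset κ} {f : κ → F[X]}
    (hirr : ∀ k ∈ K, Irreducible (f k)) (hmon : ∀ k ∈ K, (f k).Monic)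
    (hinj : Set.InjOn f K) {h : F[X]} (hh : Squarefree h) (hdvd : ∀ k ∈ K, f k ∣ h)
    (e : κ → ℕ) (n : ℕ) :
    ∏ k ∈ K, f k ^ e k ∣ h ^ n ↔ ∀ k ∈ K, e k ≤ n := by
  constructor
  · intro H k hk
    have h1 : f k ^ e k ∣ h ^ n := (Finset.dvd_prod_of_mem (fun k ↦ f k ^ e k) hk).trans H
    by_contra! hlt
    obtain ⟨c, hc⟩ := hdvd k hk
    have h2 : f k ^ n * f k ∣ f k ^ n * c ^ n := by
      rw [hc, mul_pow] at h1
      rw [← pow_succ]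
      exact (pow_dvd_pow (f k) (Nat.succ_le_of_lt hlt)).trans h1
    have h3 : f k ∣ c ^ n :=
      (mul_dvd_mul_iff_left (pow_ne_zero _ (hirr k hk).ne_zero)).mp h2
    have h4 : f k ∣ c := (hirr k hk).prime.dvd_of_dvd_pow h3
    have h5 : f k * f k ∣ h := hc.symm ▸ mul_dvd_mul_left (f k) h4
    exact (hirr k hk).not_isUnit (hh (f k) h5)
  · intro H
    refine Finset.prod_dvd_of_coprime (fun k hk l hl hkl ↦ IsCoprime.pow ?_)
      fun k hk ↦ (pow_dvd_pow _ (H k hk)).trans (pow_dvd_pow_of_dvd (hdvd k hk) n)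
    refine (hirr k hk).coprime_iff_not_dvd.mpr fun hd ↦ hkl (hinj hk hl ?_)
    exact eq_of_monic_of_associated (hmon k hk) (hmon l hl)
      ((hirr k hk).associated_of_dvd (hirr l hl) hd)

lemma reverse_pow_of_domain (f : F[X]) (n : ℕ) : (f ^ n).reverse = f.reverse ^ n := by
  induction n with
  | zero => simpa using reverse_C (1 : F)
  | succ n ih => rw [pow_succ, reverse_mul_of_domain, ih, pow_succ]

lemma reverse_prod_of_domain {κ : Type*} (K : Finset κ) (f : κ → F[X]) :
    (∏ k ∈ K, f k).reverse = ∏ k ∈ K, (f k).reverse := by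
  classical
  induction K using Finset.induction_on with
  | empty => simpa using reverse_C (1 : F)
  | insert a K ha ih => rw [Finset.prod_insert ha, Finset.prod_insert ha, reverse_mul_of_domain, ih]

variable {E : Type*} [Field E] [Algebra F E]

lemma minpoly_inv_dvd_reverse {x : E} (hx : x ≠ 0) : minpoly F x⁻¹ ∣ (minpoly F x).reverse := by
  refine minpoly.dvd _ _ ?_
  let _ : Invertible x := invertibleOfNonzero hx
  have h := eval₂_reverse_mul_pow (algebraMap F E) x (minpoly F x)
  rw [invOf_eq_inv, ← aeval_def, ← aeval_def, minpoly.aeval] at h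
  exact (mul_eq_zero.mp h).resolve_right (pow_ne_zero _ hx)

lemma natDegree_minpoly_inv_le {x : E} (hx : x ≠ 0) (hi : IsIntegral F x) :
    (minpoly F x⁻¹).natDegree ≤ (minpoly F x).natDegree :=
  (natDegree_le_of_dvd (minpoly_inv_dvd_reverse hx)
    (by simpa using minpoly.ne_zero hi)).trans (reverse_natDegree_le _)

/-- The reverse of the minimal polynomial of `x` is that of `x⁻¹`, up to a constant. -/
lemma associated_reverse_minpoly {x : E} (hx : x ≠ 0) (hi : IsIntegral F x) :
    Associated (minpoly F x).reverse (minpoly F x⁻¹) := by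
  have hi' : IsIntegral F x⁻¹ := hi.inv
  have h0 : (minpoly F x).reverse ≠ 0 := by simpa using minpoly.ne_zero hi
  refine (associated_of_dvd_of_natDegree_le (minpoly_inv_dvd_reverse hx) h0 ?_).symm
  have := natDegree_minpoly_inv_le (inv_ne_zero hx) hi'
  rw [inv_inv] at this
  exact (reverse_natDegree_le _).trans this

lemma pow_eq_algebraMap_of_minpoly_eq {x y : E} (h : minpoly F x = minpoly F y) {n : ℕ} {c : F}
    (hx : x ^ n = algebraMap F E c) : y ^ n = algebraMap F E c := by
  have h1 : minpoly F x ∣ X ^ n - C c := minpoly.dvd _ _ (by simp [hx])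
  rw [h] at h1
  simpa [sub_eq_zero] using aeval_eq_zero_of_dvd_aeval_eq_zero h1 (minpoly.aeval F y)

/-- An element fixed by the `q`-power map lies in `F`. -/
lemma exists_algebraMap_eq_of_pow_card_eq [Fintype F] {x : E} (hx : x ^ Fintype.card F = x) :
    ∃ c, algebraMap F E c = x := by
  have h1 : ∏ c : F, (X - C c) = X ^ Fintype.card F - X := by
    have h := prod_multiset_X_sub_C_of_monic_of_roots_card_eq
      (monic_X_pow_sub (p := (X : F[X])) (n := Fintype.card F)
        (by rw [degree_X]; exact_mod_cast Fintype.one_lt_card))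
      (by rw [FiniteField.roots_X_pow_card_sub_X,
        FiniteField.X_pow_card_sub_X_natDegree_eq F Fintype.one_lt_card]; rfl)
    rwa [FiniteField.roots_X_pow_card_sub_X] at h
  have h2 := congrArg (aeval x) h1
  rw [map_prod, map_sub, map_pow, aeval_X, hx, sub_self, Finset.prod_eq_zero_iff] at h2
  obtain ⟨c, -, hc⟩ := h2
  exact ⟨c, (sub_eq_zero.mp (by simpa using hc)).symm⟩

end Factors

section Exponents

lemma two_pow_dvd_of_dvd_three_pow_sub_one {k d : ℕ} (hk : 2 ≤ k)
    (h : (2 : ℤ) ^ k ∣ 3 ^ d - 1) : 2 ^ (k - 2) ∣ d := by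
  rcases Nat.eq_zero_or_pos d with rfl | hd
  · simp
  have h4 : (4 : ℤ) ∣ 3 ^ d - 1 := (pow_dvd_pow (2 : ℤ) hk).trans h
  rcases Nat.even_or_odd d with he | ⟨e, rfl⟩
  · have h1 := Int.two_pow_sub_pow (x := 3) (y := 1) (n := d) (by norm_num) (by norm_num) he
    have e4 : emultiplicity (2 : ℤ) (3 + 1) = 2 := by
      rw [show (3 + 1 : ℤ) = 2 ^ 2 by norm_num]
      exact emultiplicity_pow_self_of_prime Int.prime_two 2
    have e2 : emultiplicity (2 : ℤ) (3 - 1) = 1 := by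
      simpa using emultiplicity_pow_self_of_prime Int.prime_two 1
    rw [one_pow, e4, e2] at h1
    have h2 := le_emultiplicity_of_pow_dvd h
    have h3 : ((k - 2 : ℕ) : ℕ∞) ≤ emultiplicity (2 : ℤ) d := by
      have hfin : FiniteMultiplicity (2 : ℤ) d :=
        Int.finiteMultiplicity_iff.mpr ⟨by norm_num, by exact_mod_cast hd.ne'⟩
      have hfin' : FiniteMultiplicity (2 : ℤ) (3 ^ d - 1) :=
        Int.finiteMultiplicity_iff.mpr ⟨by norm_num, by
          have : (1 : ℤ) < 3 ^ d := one_lt_pow₀ (by norm_num) hd.ne'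
          omega⟩
      rw [hfin.emultiplicity_eq_multiplicity, hfin'.emultiplicity_eq_multiplicity] at h1
      rw [hfin'.emultiplicity_eq_multiplicity] at h2
      rw [hfin.emultiplicity_eq_multiplicity]
      norm_cast at h1 h2 ⊢
      omega
    exact_mod_cast pow_dvd_of_le_emultiplicity h3
  · exfalso
    have : (3 : ℤ) ^ (2 * e + 1) ≡ 3 [ZMOD 4] := by
      rw [pow_succ, pow_mul]
      simpa using ((show (3 ^ 2 : ℤ) ≡ 1 [ZMOD 4] by decide).pow e).mul_right 3
    have := this.symm.dvd
    generalize (3 : ℤ) ^ (2 * e + 1) = y at *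
    omega

lemma three_pow_inj_of_dvd_sub {k v w : ℕ} (hk : 2 ≤ k) (hv : v < 2 ^ (k - 2))
    (hw : w < 2 ^ (k - 2)) (h : (2 : ℤ) ^ k ∣ 3 ^ v - 3 ^ w) : v = w := by
  wlog hvw : w ≤ v generalizing v w
  · exact (this hw hv (by rwa [dvd_sub_comm]) (by omega)).symm
  obtain ⟨d, rfl⟩ := Nat.exists_eq_add_of_le hvw
  have h1 : (2 : ℤ) ^ k ∣ 3 ^ w * (3 ^ d - 1) := by rwa [mul_sub, mul_one, ← pow_add]
  have h2 : IsCoprime ((2 : ℤ) ^ k) (3 ^ w) :=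
    IsCoprime.pow (Int.isCoprime_iff_gcd_eq_one.mpr (by norm_num))
  have h3 := two_pow_dvd_of_dvd_three_pow_sub_one hk (h2.dvd_of_dvd_mul_left h1)
  have := Nat.eq_zero_of_dvd_of_lt h3 (by omega)
  omega

lemma three_pow_emod_eight (v : ℕ) : (3 : ℤ) ^ v % 8 = 1 ∨ (3 : ℤ) ^ v % 8 = 3 := by
  induction v with
  | zero => simp
  | succ v ih => rw [pow_succ]; omega

lemma not_two_pow_dvd_three_pow_add {k v w : ℕ} (hk : 2 ≤ k) (hv : v < 2 ^ (k - 2))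
    (hw : w < 2 ^ (k - 2)) : ¬ (2 : ℤ) ^ k ∣ 3 ^ v + 3 ^ w := by
  intro h
  rcases hk.eq_or_lt with rfl | hk
  · obtain rfl : v = 0 := by simpa using hv
    obtain rfl : w = 0 := by simpa using hw
    norm_num at h
  · have h8 : (8 : ℤ) ∣ 3 ^ v + 3 ^ w := (pow_dvd_pow (2 : ℤ) hk).trans h
    have := three_pow_emod_eight v
    have := three_pow_emod_eight w
    omega

lemma mem_Dfin_iff {a i : ℕ} {u : ℤ} :
    u ∈ Dfin a i ↔ ∃ v < 2 ^ (min i a - 2), u = 3 ^ v ∨ u = -3 ^ v := by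
  unfold Dfin
  split_ifs with h
  · rw [min_eq_left h]
    simp only [Finset.mem_union, Finset.mem_image, Finset.mem_range]
    grind
  · rw [min_eq_right (by omega)]
    simp only [Finset.mem_union, Finset.mem_image, Finset.mem_range]
    grind

lemma neg_mem_Dfin {a i : ℕ} {u : ℤ} (hu : u ∈ Dfin a i) : -u ∈ Dfin a i := by
  obtain ⟨v, hv, rfl | rfl⟩ := mem_Dfin_iff.mp hu
  · exact mem_Dfin_iff.mpr ⟨v, hv, .inr rfl⟩
  · exact mem_Dfin_iff.mpr ⟨v, hv, .inl (neg_neg _)⟩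

lemma odd_of_mem_Dfin {a i : ℕ} {u : ℤ} (hu : u ∈ Dfin a i) : Odd u := by
  have h3 : ∀ v : ℕ, Odd ((3 : ℤ) ^ v) := fun v ↦ Odd.pow (by decide)
  obtain ⟨v, -, rfl | rfl⟩ := mem_Dfin_iff.mp hu
  · exact h3 v
  · exact (h3 v).neg

/-- The elements of `Dfin a i` are pairwise incongruent modulo `2 ^ min i a`. -/
lemma Dfin_inj_of_dvd_sub {a i : ℕ} (ha : 2 ≤ a) (hi : 2 ≤ i) {u u' : ℤ} (hu : u ∈ Dfin a i)
    (hu' : u' ∈ Dfin a i) (h : (2 : ℤ) ^ min i a ∣ u - u') : u = u' := by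
  have hk : 2 ≤ min i a := le_min hi ha
  obtain ⟨v, hv, rfl | rfl⟩ := mem_Dfin_iff.mp hu <;>
    obtain ⟨w, hw, rfl | rfl⟩ := mem_Dfin_iff.mp hu'
  · rw [three_pow_inj_of_dvd_sub hk hv hw h]
  · exact (not_two_pow_dvd_three_pow_add hk hv hw (by simpa using h)).elim
  · refine (not_two_pow_dvd_three_pow_add hk hv hw ?_).elim
    rwa [← dvd_neg, neg_add']
  · rw [three_pow_inj_of_dvd_sub hk hw hv]
    rwa [neg_sub_neg] at h

/-- The sets `D_i`, completed by `D_0 = {0}` and `D_1 = {1}`. -/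
def cosetReps (a : ℕ) : ℕ → Finset ℤ
  | 0 => {0}
  | 1 => {1}
  | i + 2 => Dfin a (i + 2)

lemma cosetReps_of_two_le {a i : ℕ} (hi : 2 ≤ i) : cosetReps a i = Dfin a i := by
  obtain ⟨i, rfl⟩ := Nat.exists_eq_add_of_le' hi
  rfl

lemma odd_of_mem_cosetReps {a i : ℕ} (hi : 1 ≤ i) {u : ℤ} (hu : u ∈ cosetReps a i) : Odd u := by
  match i, hi with
  | 1, _ => rw [Finset.mem_singleton.mp hu]; decide
  | i + 2, _ => exact odd_of_mem_Dfin (i := i + 2) hu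

lemma cosetReps_inj_of_dvd_sub {a i : ℕ} (ha : 2 ≤ a) {u u' : ℤ} (hu : u ∈ cosetReps a i)
    (hu' : u' ∈ cosetReps a i) (h : (2 : ℤ) ^ min i a ∣ u - u') : u = u' := by
  match i with
  | 0 => rw [Finset.mem_singleton.mp hu, Finset.mem_singleton.mp hu']
  | 1 => rw [Finset.mem_singleton.mp hu, Finset.mem_singleton.mp hu']
  | i + 2 => exact Dfin_inj_of_dvd_sub ha (by omega) hu hu' h

end Exponents

section CosetRepresentatives

variable {F : Type*} [Field F] {E : Type*} [Field E] [Algebra F E] {β : E} {r : ℕ}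

lemma zpow_pow_eq_one_iff (hβ : IsPrimitiveRoot β (2 ^ r)) (t : ℤ) (n : ℕ) :
    (β ^ t) ^ n = 1 ↔ (2 : ℤ) ^ r ∣ t * n := by
  rw [← zpow_natCast, ← zpow_mul, hβ.zpow_eq_one_iff_dvd]
  norm_cast

lemma zpow_pow_eq_iff (hβ : IsPrimitiveRoot β (2 ^ r)) (t t' : ℤ) (n : ℕ) :
    (β ^ t) ^ n = (β ^ t') ^ n ↔ (2 : ℤ) ^ r ∣ (t - t') * n := by
  have h0 : β ≠ 0 := hβ.ne_zero (by positivity)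
  rw [← zpow_pow_eq_one_iff hβ, zpow_sub₀ h0, div_pow,
    div_eq_one_iff_eq (pow_ne_zero _ (zpow_ne_zero _ h0))]

lemma two_pow_dvd_mul_iff {i : ℕ} (hi : i ≤ r) (u : ℤ) :
    (2 : ℤ) ^ r ∣ 2 ^ (r - i) * u ↔ 2 ^ i ∣ u := by
  nth_rw 1 [← Nat.sub_add_cancel hi]
  rw [pow_add, mul_dvd_mul_iff_left (by positivity)]

lemma le_of_minpoly_eq (hβ : IsPrimitiveRoot β (2 ^ r)) {i i' : ℕ} (hi : i ≤ r) (hi' : i' ≤ r)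
    {u u' : ℤ} (hu' : 1 ≤ i' → Odd u')
    (h : minpoly F (β ^ ((2 : ℤ) ^ (r - i) * u)) = minpoly F (β ^ ((2 : ℤ) ^ (r - i') * u'))) :
    i' ≤ i := by
  by_contra! hlt
  have h1 : (β ^ ((2 : ℤ) ^ (r - i) * u)) ^ 2 ^ i = algebraMap F E 1 := by
    rw [map_one, zpow_pow_eq_one_iff hβ, mul_assoc, two_pow_dvd_mul_iff hi]
    simp
  have h2 := pow_eq_algebraMap_of_minpoly_eq h h1
  rw [map_one, zpow_pow_eq_one_iff hβ, mul_assoc, two_pow_dvd_mul_iff hi'] at h2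
  obtain ⟨d, rfl⟩ := Nat.exists_eq_add_of_lt hlt
  have h3 : (2 : ℤ) ^ (d + 1) ∣ u' := by
    rw [add_assoc, pow_add, mul_comm u'] at h2
    push_cast at h2
    exact (mul_dvd_mul_iff_left (by positivity)).mp h2
  have h4 : (2 : ℤ) ∣ u' := (dvd_pow_self 2 (by omega)).trans h3
  have h5 := hu' (by omega)
  rw [← Int.not_even_iff_odd, even_iff_two_dvd] at h5
  exact h5 h4

/-- Distinct representatives give distinct minimal polynomials. -/
lemma minpoly_zpow_inj [Fintype F] {a b : ℕ} (ha : 2 ≤ a) (hq : Fintype.card F = 2 ^ a * b + 1)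
    (hβ : IsPrimitiveRoot β (2 ^ r)) {i i' : ℕ} (hi : i ≤ r) (hi' : i' ≤ r) {u u' : ℤ}
    (hu : u ∈ cosetReps a i) (hu' : u' ∈ cosetReps a i')
    (h : minpoly F (β ^ ((2 : ℤ) ^ (r - i) * u)) = minpoly F (β ^ ((2 : ℤ) ^ (r - i') * u'))) :
    i = i' ∧ u = u' := by
  obtain rfl : i = i' := le_antisymm
    (le_of_minpoly_eq hβ hi' hi (odd_of_mem_cosetReps · hu) h.symm)
    (le_of_minpoly_eq hβ hi hi' (odd_of_mem_cosetReps · hu') h)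
  refine ⟨rfl, cosetReps_inj_of_dvd_sub ha hu hu' ?_⟩
  set t := (2 : ℤ) ^ (r - i) * u with ht
  have hfix : ((β ^ t) ^ 2 ^ (i - a)) ^ Fintype.card F = (β ^ t) ^ 2 ^ (i - a) := by
    rw [hq, pow_succ, ← pow_mul,
      (zpow_pow_eq_one_iff hβ t (2 ^ (i - a) * (2 ^ a * b))).mpr, one_mul]
    rw [ht, mul_assoc, two_pow_dvd_mul_iff hi]
    push_cast
    rw [← mul_assoc (2 ^ (i - a) : ℤ), ← pow_add]
    exact ((pow_dvd_pow 2 (by omega)).mul_right _).mul_left _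
  obtain ⟨c, hc⟩ := exists_algebraMap_eq_of_pow_card_eq hfix
  have h1 := pow_eq_algebraMap_of_minpoly_eq h hc.symm
  rw [hc, eq_comm, zpow_pow_eq_iff hβ, ht, ← mul_sub, mul_assoc,
    two_pow_dvd_mul_iff hi] at h1
  rw [show i = (i - a) + min i a by omega, pow_add, mul_comm (u - u')] at h1
  push_cast at h1
  rw [show i - a + min i a - a = i - a by omega] at h1
  exact (mul_dvd_mul_iff_left (by positivity)).mp h1

/-- The pairs `(i, u)` with `0 ≤ i ≤ r` and `u ∈ D_i`. -/
def cosetIndex (a r : ℕ) : Finset (Σ _ : ℕ, ℤ) :=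
  (Finset.range (r + 1)).sigma (cosetReps a)

/-- The exponent `2 ^ (r - i) * u` attached to `(i, u)`. -/
def cosetExp (r : ℕ) (k : Σ _ : ℕ, ℤ) : ℤ := 2 ^ (r - k.1) * k.2

/-- Negation of exponents modulo `2 ^ r`, on the level of indices. -/
def cosetNeg (k : Σ _ : ℕ, ℤ) : Σ _ : ℕ, ℤ := ⟨k.1, if k.1 < 2 then k.2 else -k.2⟩

lemma cosetNeg_cosetNeg (k : Σ _ : ℕ, ℤ) : cosetNeg (cosetNeg k) = k := by
  obtain ⟨i, u⟩ := k
  by_cases h : i < 2 <;> simp [cosetNeg, h]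

lemma cosetNeg_mem {a r : ℕ} {k : Σ _ : ℕ, ℤ} (hk : k ∈ cosetIndex a r) :
    cosetNeg k ∈ cosetIndex a r := by
  obtain ⟨i, u⟩ := k
  simp only [cosetIndex, Finset.mem_sigma, cosetNeg] at hk ⊢
  refine ⟨hk.1, ?_⟩
  split_ifs with h
  · exact hk.2
  · rw [cosetReps_of_two_le (by omega)] at hk ⊢
    exact neg_mem_Dfin hk.2

lemma prod_cosetIndex {M : Type*} [CommMonoid M] {a r : ℕ} (hr : 2 ≤ r) (f : ℤ → M) :
    ∏ k ∈ cosetIndex a r, f (cosetExp r k) =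
      f 0 * f (2 ^ (r - 1)) * ∏ i ∈ Finset.Icc 2 r, ∏ u ∈ Dfin a i, f (2 ^ (r - i) * u) := by
  have h : Finset.range (r + 1) = insert 0 (insert 1 (Finset.Icc 2 r)) := by
    ext x
    simp only [Finset.mem_range, Finset.mem_insert, Finset.mem_Icc]
    omega
  rw [cosetIndex, Finset.prod_sigma, h, Finset.prod_insert (by simp), Finset.prod_insert (by simp),
    mul_assoc]
  congr 1
  · simp [cosetReps, cosetExp]
  congr 1
  · simp [cosetReps, cosetExp]
  refine Finset.prod_congr rfl fun i hi ↦ ?_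
  rw [cosetReps_of_two_le (Finset.mem_Icc.mp hi).1]
  rfl

lemma forall_cosetIndex {P : ℤ → ℤ → Prop} {a r : ℕ} (hr : 2 ≤ r) :
    (∀ k ∈ cosetIndex a r, P (cosetExp r k) (cosetExp r (cosetNeg k))) ↔
      P 0 0 ∧ P (2 ^ (r - 1)) (2 ^ (r - 1)) ∧
        ∀ i ∈ Finset.Icc 2 r, ∀ u ∈ Dfin a i, P (2 ^ (r - i) * u) (2 ^ (r - i) * (-u)) := by
  simp only [cosetIndex, cosetExp, cosetNeg, Finset.mem_sigma, Sigma.forall, Finset.mem_range,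
    Finset.mem_Icc]
  constructor
  · intro h
    refine ⟨?_, ?_, fun i hi u hu ↦ ?_⟩
    · simpa using h 0 0 ⟨by omega, by simp [cosetReps]⟩
    · simpa using h 1 1 ⟨by omega, by simp [cosetReps]⟩
    · have := h i u ⟨by omega, by rwa [cosetReps_of_two_le hi.1]⟩
      rwa [if_neg (by omega)] at this
  · rintro ⟨h0, h1, h2⟩ i u ⟨hi, hu⟩
    match i, hu with
    | 0, hu => simpa [Finset.mem_singleton.mp hu] using h0
    | 1, hu => simpa [Finset.mem_singleton.mp hu] using h1
    | i + 2, hu => simpa using h2 (i + 2) ⟨by omega, by omega⟩ u hu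

lemma minpoly_cosetNeg (hβ : IsPrimitiveRoot β (2 ^ r)) {a : ℕ} {k : Σ _ : ℕ, ℤ}
    (hk : k ∈ cosetIndex a r) :
    minpoly F (β ^ cosetExp r k)⁻¹ = minpoly F (β ^ cosetExp r (cosetNeg k)) := by
  congr 1
  obtain ⟨i, u⟩ := k
  simp only [cosetIndex, Finset.mem_sigma, Finset.mem_range] at hk
  obtain ⟨hi, hu⟩ := hk
  match i, hi, hu with
  | 0, _, hu => simp [cosetExp, cosetNeg, Finset.mem_singleton.mp hu]
  | 1, hi, hu =>
    refine inv_eq_of_mul_eq_one_right ?_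
    rw [cosetNeg, if_pos Nat.one_lt_two, ← sq, zpow_pow_eq_one_iff hβ, cosetExp, mul_assoc,
      two_pow_dvd_mul_iff (show 1 ≤ r by omega)]
    simp
  | i + 2, _, _ => simp [cosetExp, cosetNeg, zpow_neg]

end CosetRepresentatives

/-- for `q = p^m = 2^a·b+1`, the cyclic code `C` of length `2^r·p^s`
generated by `m_0^{j_0}·m_{2^{r−1}}^{j_{2^{r−1}}}·∏_{i=2}^r ∏_{u∈D_i} m_{2^{r−i}u}^{j_{2^{r−i}u}}`
satisfies `C^⊥ ⊆ C` iff `2j_0 < p^s`, `2j_{2^{r−1}} < p^s`, and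
`j_{2^{r−i}u} + j_{2^{r−i}(−u)} ≤ p^s` for all `u ∈ D_i`, `2 ≤ i ≤ r`. -/
theorem stmt10 (p m a b r s : ℕ) (hp : p.Prime) (hpodd : Odd p) (hm : 0 < m) (hs : 0 < s)
    (hb : Odd b) (ha : 2 ≤ a) (hr : 2 ≤ r) (hq : p ^ m = 2 ^ a * b + 1)
    (F : Type*) [Field F] [Fintype F] (hF : Fintype.card F = p ^ m)
    (E : Type*) [Field E] [Algebra F E] (β : E) (hβ : IsPrimitiveRoot β (2 ^ r))
    (N : ℕ) (hN : N = 2 ^ r * p ^ s) (hf : (X ^ N - 1 : Polynomial F) ≠ 0)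
    (j : ℤ → ℕ) (hj : ∀ t ∈ ({0, 2 ^ (r - 1)} : Finset ℤ) ∪
      (Finset.Icc 2 r).biUnion (fun i => (Dfin a i).image fun u => 2 ^ (r - i) * u), j t ≤ p ^ s)
    (C : Ideal (AdjoinRoot (X ^ N - 1 : Polynomial F)))
    (hC : C = Ideal.span {AdjoinRoot.mk (X ^ N - 1 : Polynomial F)
      (minpoly F (β ^ (0 : ℤ)) ^ j 0 *
        minpoly F (β ^ ((2 : ℤ) ^ (r - 1))) ^ j (2 ^ (r - 1)) *
        ∏ i ∈ Finset.Icc 2 r, ∏ u ∈ Dfin a i,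
          minpoly F (β ^ ((2 : ℤ) ^ (r - i) * u)) ^ j (2 ^ (r - i) * u))}) :
    dualCode hf C ⊆ ↑C ↔
      2 * j 0 < p ^ s ∧ 2 * j (2 ^ (r - 1)) < p ^ s ∧
        ∀ i ∈ Finset.Icc 2 r, ∀ u ∈ Dfin a i,
          j (2 ^ (r - i) * u) + j (2 ^ (r - i) * (-u)) ≤ p ^ s := by
  have : Fact p.Prime := ⟨hp⟩
  have hchar : CharP F p := charP_of_card_eq_prime_pow hF
  have hNpos : 0 < N := by
    rw [hN]
    exact Nat.mul_pos (by positivity) (Nat.pow_pos hp.pos)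
  have hfact : (X ^ N - 1 : F[X]) = (X ^ 2 ^ r - 1) ^ p ^ s := by
    rw [sub_pow_expChar_pow, one_pow, ← pow_mul, hN]
  have h2 : ((2 ^ r : ℕ) : F) ≠ 0 := by
    rw [Ne, CharP.cast_eq_zero_iff F p]
    intro h
    have h3 := (Nat.prime_dvd_prime_iff_eq hp Nat.prime_two).mp (hp.dvd_of_dvd_pow h)
    exact absurd hpodd (by rw [h3]; decide)
  have hsq : Squarefree (X ^ 2 ^ r - 1 : F[X]) := (X_pow_sub_one_separable_iff.mpr h2).squarefree
  set μ : (Σ _ : ℕ, ℤ) → F[X] := fun k ↦ minpoly F (β ^ cosetExp r k) with hμ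
  have hroot : ∀ t : ℤ, aeval (β ^ t) (X ^ 2 ^ r - 1 : F[X]) = 0 := fun t ↦ by
    have := (zpow_pow_eq_one_iff hβ t (2 ^ r)).mpr (by simp)
    simp [this]
  have hint : ∀ t : ℤ, IsIntegral F (β ^ t) := fun t ↦
    ⟨X ^ 2 ^ r - 1, monic_X_pow_sub_C 1 (by positivity), by rw [← aeval_def, hroot]⟩
  have hdvd : ∀ e : (Σ _ : ℕ, ℤ) → ℕ,
      ∏ k ∈ cosetIndex a r, μ k ^ e k ∣ X ^ N - 1 ↔ ∀ k ∈ cosetIndex a r, e k ≤ p ^ s := by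
    intro e
    rw [hfact]
    refine prod_pow_dvd_pow_iff (fun k _ ↦ minpoly.irreducible (hint _))
      (fun k _ ↦ minpoly.monic (hint _)) ?_ hsq (fun k _ ↦ minpoly.dvd _ _ (hroot _)) e (p ^ s)
    rintro ⟨i, u⟩ hk ⟨i', u'⟩ hk' h
    simp only [cosetIndex, Finset.mem_coe, Finset.mem_sigma, Finset.mem_range] at hk hk'
    obtain ⟨rfl, rfl⟩ := minpoly_zpow_inj ha (hF.trans hq) hβ (by omega) (by omega) hk.2 hk'.2 h
    rfl
  have hg := prod_cosetIndex (a := a) hr fun t ↦ minpoly F (β ^ t) ^ j t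
  rw [← hg] at hC
  set g := ∏ k ∈ cosetIndex a r, minpoly F (β ^ cosetExp r k) ^ j (cosetExp r k) with hgdef
  have hrev : Associated g.reverse (∏ k ∈ cosetIndex a r, μ k ^ j (cosetExp r (cosetNeg k))) := by
    have h1 : ∏ k ∈ cosetIndex a r, μ k ^ j (cosetExp r (cosetNeg k)) =
        ∏ k ∈ cosetIndex a r, μ (cosetNeg k) ^ j (cosetExp r k) :=
      Finset.prod_nbij' cosetNeg cosetNeg (fun _ ↦ cosetNeg_mem) (fun _ ↦ cosetNeg_mem)
        (fun k _ ↦ cosetNeg_cosetNeg k) (fun k _ ↦ cosetNeg_cosetNeg k)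
        (fun k _ ↦ by rw [cosetNeg_cosetNeg])
    rw [h1, hgdef, reverse_prod_of_domain]
    refine Associated.prod _ _ _ fun k hk ↦ ?_
    simp only [hμ, reverse_pow_of_domain, ← minpoly_cosetNeg hβ hk]
    exact (associated_reverse_minpoly
      (zpow_ne_zero _ (hβ.ne_zero (by positivity))) (hint _)).pow_pow
  have hjK : ∀ k ∈ cosetIndex a r, j (cosetExp r k) ≤ p ^ s := by
    have h := (forall_cosetIndex (P := fun t _ ↦ j t ≤ p ^ s) (a := a) hr).mpr
    refine h ⟨hj 0 (by simp), hj _ (by simp), fun i hi u hu ↦ hj _ ?_⟩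
    exact Finset.mem_union_right _
      (Finset.mem_biUnion.mpr ⟨i, hi, Finset.mem_image_of_mem _ hu⟩)
  have hgd : g ∣ X ^ N - 1 := (hdvd _).mpr hjK
  have hgd' : g.reverse ∣ X ^ N - 1 :=
    hrev.dvd_iff_dvd_left.mpr ((hdvd _).mpr fun k hk ↦ hjK _ (cosetNeg_mem hk))
  rw [hC, dualCode_span_subset_iff hNpos hf hgd hgd', (hrev.mul_right g).dvd_iff_dvd_left, hgdef,
    ← Finset.prod_mul_distrib]
  simp_rw [hμ, ← pow_add]
  rw [hdvd, forall_cosetIndex (P := fun t t' ↦ j t' + j t ≤ p ^ s) hr]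
  have hodd : Odd (p ^ s) := hpodd.pow
  have hlt : ∀ n, n + n ≤ p ^ s ↔ 2 * n < p ^ s := fun n ↦ by
    obtain ⟨c, hc⟩ := hodd
    omega
  simp only [hlt, add_comm]
end

section
/- Let p be an odd prime, q = p^m with q = 2^a·b + 1, b odd, a ≥ r ≥ 1, and N = 2^r·p^s. Let θ ∈ F_q be a primitive 2^r-th root of unity, let (i_0, …, i_{2^r−1}) be a permutation of (0, …, 2^r−1), and let p^s ≥ j_0 ≥ j_1 ≥ … ≥ j_{2^r−1} ≥ 0 be integers, not all equal to p^s. Let C be the ideal of F_q[x]/(x^N − 1) generated by ∏_{h=0}^{2^r−1} (x − θ^{i_h})^{j_h}, and let N₀ = #{ h : j_h = p^s }. Then: (1) if j_{2^r−1} = 0 then d_H(C) ≤ 2^r; (2) if j_{2^r−1} > 0 then d_H(C) = min{ (τ_h+2)·p^{k_h} · d_H(C_{t_h}) : N₀ ≤ h ≤ 2^r−1 }. -/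
open Polynomial
open scoped Classical

/-- The Hamming weight of a codeword: the number of nonzero coordinates of its
coefficient vector. -/
noncomputable def hammingWeight {F : Type*} [Field F] {f : Polynomial F} (hf : f ≠ 0)
    (x : AdjoinRoot f) : ℕ :=
  (Finset.univ.filter fun i => coeffRepr hf x i ≠ 0).card

/-- The Hamming distance of a code `C ⊆ F[x]/(f)`: the minimum Hamming weight of a
nonzero codeword. -/
noncomputable def dHamming {F : Type*} [Field F] {f : Polynomial F} (hf : f ≠ 0)
    (C : Ideal (AdjoinRoot f)) : ℕ :=
  sInf {w | ∃ x ∈ C, x ≠ 0 ∧ w = hammingWeight hf x}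

/-- The last index `2^r − 1` of `Fin (2^r)`. -/
def lastIdx (r : ℕ) : Fin (2 ^ r) := ⟨2 ^ r - 1, Nat.sub_lt (Nat.two_pow_pos r) Nat.one_pos⟩

namespace RepeatedRootCode

/-- The polynomial `∑ k, a_{i + n k} X ^ k`, collecting the coefficients of `f = ∑ k, a_k X ^ k`
whose index is `i + n k` for some `k`. -/
noncomputable def residuePart {F : Type*} [Field F] (n i : ℕ) (f : F[X]) : F[X] :=
  ∑ k ∈ Finset.range (f.natDegree + 1), monomial k (f.coeff (i + n * k))

section Sections

variable {F : Type*} [Field F] {n i : ℕ}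

theorem coeff_residuePart (hn : 0 < n) (f : F[X]) (k : ℕ) :
    (residuePart n i f).coeff k = f.coeff (i + n * k) := by
  simp only [residuePart, finsetSum_coeff, coeff_monomial, Finset.sum_ite_eq',
    Finset.mem_range]
  split_ifs with h
  · rfl
  · rw [coeff_eq_zero_of_natDegree_lt]
    nlinarith

theorem residuePart_add (hn : 0 < n) (f g : F[X]) :
    residuePart n i (f + g) = residuePart n i f + residuePart n i g := by
  ext k
  simp [coeff_residuePart hn]

theorem residuePart_expand_mul (hi : i < n) (u f : F[X]) :
    residuePart n i (expand F n u * f) = u * residuePart n i f := by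
  have hn : 0 < n := by omega
  induction u using Polynomial.induction_on' with
  | add u v hu hv => rw [map_add, add_mul, residuePart_add hn, hu, hv, add_mul]
  | monomial d c =>
    ext k
    rw [coeff_residuePart hn, expand_monomial, ← C_mul_X_pow_eq_monomial, ← C_mul_X_pow_eq_monomial,
      mul_assoc, mul_assoc, coeff_C_mul, coeff_C_mul, coeff_X_pow_mul', coeff_X_pow_mul',
      coeff_residuePart hn]
    by_cases hdk : d ≤ k
    · obtain ⟨e, rfl⟩ := Nat.exists_eq_add_of_le hdk
      rw [if_pos (by nlinarith), if_pos hdk]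
      congr 2
      rw [Nat.add_sub_cancel_left, mul_add, mul_comm d n]
      omega
    · rw [if_neg hdk, if_neg]
      intro h
      have : n * (k + 1) ≤ n * d := Nat.mul_le_mul_left n (by omega)
      nlinarith

theorem sum_card_support_residuePart (hn : 0 < n) (f : F[X]) :
    ∑ i ∈ Finset.range n, (residuePart n i f).support.card = f.support.card := by
  rw [Finset.card_eq_sum_card_fiberwise (f := fun k => k % n) (t := Finset.range n)
    (fun k _ => by simpa using Nat.mod_lt k hn)]
  refine Finset.sum_congr rfl fun i hi => ?_
  rw [Finset.mem_range] at hi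
  refine Finset.card_nbij' (fun k => i + n * k) (fun k => k / n) ?_ ?_ ?_ ?_
  · intro k hk
    simpa [coeff_residuePart hn, Nat.mod_eq_of_lt hi] using hk
  · intro k hk
    simp only [Finset.coe_filter, Set.mem_ofPred_eq, mem_support_iff] at hk
    simp only [Finset.mem_coe, mem_support_iff, coeff_residuePart hn]
    rw [← hk.2, Nat.mod_add_div]
    exact hk.1
  · intro k _
    simp [Nat.add_mul_div_left _ _ hn, Nat.div_eq_of_lt hi]
  · intro k hk
    simp only [Finset.coe_filter, Set.mem_ofPred_eq, mem_support_iff] at hk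
    simp only [← hk.2, Nat.mod_add_div]

theorem monic_X_pow_sub_one (hn : 0 < n) : (X ^ n - 1 : F[X]).Monic :=
  monic_X_pow_sub_C 1 hn.ne'

theorem natDegree_X_pow_sub_one (n : ℕ) : (X ^ n - 1 : F[X]).natDegree = n :=
  natDegree_X_pow_sub_C (r := (1 : F))

theorem degree_lt_iff_natDegree_lt_of_pos {f : F[X]} (hn : 0 < n) :
    f.degree < n ↔ f.natDegree < n := by
  rcases eq_or_ne f 0 with rfl | hf
  · simp [hn]
  · exact (natDegree_lt_iff_degree_lt hf).symm

theorem degree_modByMonic_X_pow_sub_one_lt (hn : 0 < n) (f : F[X]) :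
    (f %ₘ (X ^ n - 1)).degree < n := by
  have h := degree_modByMonic_lt f (monic_X_pow_sub_one (F := F) hn)
  rwa [degree_eq_natDegree (monic_X_pow_sub_one hn).ne_zero, natDegree_X_pow_sub_one] at h

theorem coeff_modByMonic_X_pow_sub_one (hi : i < n) (f : F[X]) :
    (f %ₘ (X ^ n - 1)).coeff i = (residuePart n i f).eval 1 := by
  have hn : 0 < n := by omega
  have hdeg := degree_modByMonic_X_pow_sub_one_lt hn f
  have hexp : (X ^ n - 1 : F[X]) = expand F n (X - 1) := by simp
  have hf : residuePart n i f = residuePart n i (f %ₘ (X ^ n - 1))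
      + (X - 1) * residuePart n i (f /ₘ (X ^ n - 1)) := by
    conv_lhs => rw [← modByMonic_add_div f (X ^ n - 1)]
    rw [residuePart_add hn]
    nth_rw 2 [hexp]
    rw [residuePart_expand_mul hi]
  have hr : residuePart n i (f %ₘ (X ^ n - 1)) = Polynomial.C ((f %ₘ (X ^ n - 1)).coeff i) := by
    ext k
    rw [coeff_residuePart hn, coeff_C]
    split_ifs with hk
    · simp [hk]
    · refine coeff_eq_zero_of_degree_lt (hdeg.trans_le ?_)
      have := Nat.le_mul_of_pos_right n (Nat.pos_of_ne_zero hk)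
      exact_mod_cast this.trans (Nat.le_add_left _ _)
  rw [hf, hr]
  simp

/-- If every polynomial vanishing to order exactly `t` at `1` has weight at least `W`, then the
weight of `(X ^ n - 1) ^ t * g` is at least `W` times the weight of `g` modulo `X ^ n - 1`. -/
theorem mul_card_support_modByMonic_le (hn : 0 < n) {t W : ℕ}
    (hW : ∀ u : F[X], u.eval 1 ≠ 0 → W ≤ ((X - 1) ^ t * u).support.card) (g : F[X]) :
    W * (g %ₘ (X ^ n - 1)).support.card ≤ ((X ^ n - 1) ^ t * g).support.card := by
  have hsub : (g %ₘ (X ^ n - 1)).support ⊆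
      (Finset.range n).filter fun i => (residuePart n i g).eval 1 ≠ 0 := by
    intro i hi
    have hin : i < n := by
      by_contra! h
      refine mem_support_iff.1 hi (coeff_eq_zero_of_degree_lt
        ((degree_modByMonic_X_pow_sub_one_lt hn g).trans_le (by exact_mod_cast h)))
    rw [mem_support_iff, coeff_modByMonic_X_pow_sub_one hin] at hi
    simpa [hin] using hi
  have hexp : ((X ^ n - 1) ^ t : F[X]) = expand F n ((X - 1) ^ t) := by simp
  rw [← sum_card_support_residuePart hn ((X ^ n - 1) ^ t * g)]
  calc W * (g %ₘ (X ^ n - 1)).support.card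
      ≤ ∑ i ∈ (Finset.range n).filter (fun i => (residuePart n i g).eval 1 ≠ 0), W := by
        rw [Finset.sum_const, smul_eq_mul, mul_comm]
        exact Nat.mul_le_mul_right _ (Finset.card_le_card hsub)
    _ ≤ ∑ i ∈ (Finset.range n).filter (fun i => (residuePart n i g).eval 1 ≠ 0),
          (residuePart n i ((X ^ n - 1) ^ t * g)).support.card := by
        refine Finset.sum_le_sum fun i hi => ?_
        rw [Finset.mem_filter, Finset.mem_range] at hi
        rw [hexp, residuePart_expand_mul hi.1]
        exact hW _ hi.2
    _ ≤ _ := Finset.sum_le_sum_of_subset (Finset.filter_subset _ _)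

theorem card_support_modByMonic_le (hn : 0 < n) (f : F[X]) :
    (f %ₘ (X ^ n - 1)).support.card ≤ f.support.card := by
  have h := mul_card_support_modByMonic_le hn (t := 0) (W := 1) (fun u hu => by
    rw [Nat.one_le_iff_ne_zero, Finset.card_ne_zero, support_nonempty]
    rintro h
    simp_all) f
  simpa using h

theorem card_support_expand_le (hn : 0 < n) (f : F[X]) :
    (expand F n f).support.card ≤ f.support.card := by
  refine (Finset.card_le_card fun k hk => ?_).trans
    (Finset.card_image_le (s := f.support) (f := fun k => k * n))
  rw [mem_support_iff, coeff_expand hn] at hk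
  split_ifs at hk with h
  · obtain ⟨d, rfl⟩ := h
    rw [Nat.mul_div_cancel_left _ hn] at hk
    exact Finset.mem_image.2 ⟨d, by simpa using hk, mul_comm _ _⟩
  · exact absurd rfl hk

end Sections

/-- The product of the numbers `d + 1` over the base-`p` digits `d` of `t`. -/
def digitProd (p t : ℕ) : ℕ := ((Nat.digits p t).map (· + 1)).prod

section DigitProd

variable {p : ℕ}

theorem digitProd_zero (p : ℕ) : digitProd p 0 = 1 := by simp [digitProd]

theorem digitProd_add_mul {d : ℕ} (hd : d < p) (t : ℕ) :
    digitProd p (d + p * t) = (d + 1) * digitProd p t := by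
  rcases Nat.eq_zero_or_pos (d + p * t) with h | h
  · obtain ⟨rfl, h⟩ := Nat.add_eq_zero_iff.1 h
    obtain rfl : t = 0 := by simpa [hd.ne'] using h
    simp [digitProd]
  · rcases (show 1 ≤ p by omega).eq_or_lt with rfl | hp
    · obtain rfl : d = 0 := by omega
      simp
    rw [digitProd, Nat.digits_def' hp h, Nat.add_mul_mod_self_left, Nat.mod_eq_of_lt hd,
      Nat.add_mul_div_left _ _ (by omega), Nat.div_eq_of_lt hd, zero_add]
    simp [digitProd]

theorem digitProd_eq_mul_div (hp : 0 < p) (t : ℕ) :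
    digitProd p t = (t % p + 1) * digitProd p (t / p) := by
  rw [← digitProd_add_mul (Nat.mod_lt t hp), Nat.mod_add_div]

theorem digitProd_pos (p t : ℕ) : 0 < digitProd p t := by
  refine Nat.pos_of_ne_zero fun h => ?_
  simp [digitProd, List.prod_eq_zero_iff] at h

theorem two_le_digitProd (hp : 1 < p) {t : ℕ} (ht : 0 < t) : 2 ≤ digitProd p t := by
  induction t using Nat.strong_induction_on with
  | _ t ih =>
    rw [digitProd_eq_mul_div (by omega)]
    rcases Nat.eq_zero_or_pos (t % p) with h | h
    · have hdiv : 0 < t / p := Nat.div_pos (Nat.le_of_dvd ht (Nat.dvd_of_mod_eq_zero h)) (by omega)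
      rw [h, zero_add, one_mul]
      exact ih _ (Nat.div_lt_self ht hp) hdiv
    · exact le_mul_of_le_of_one_le (by omega) (digitProd_pos _ _)

theorem digitProd_add_pow_mul (hp : 0 < p) (e : ℕ) {c : ℕ} (hc : c < p ^ e) (t : ℕ) :
    digitProd p (c + p ^ e * t) = digitProd p c * digitProd p t := by
  induction e generalizing c with
  | zero =>
    obtain rfl : c = 0 := by simpa using hc
    simp [digitProd_zero]
  | succ e ih =>
    have hc' : c / p < p ^ e := Nat.div_lt_of_lt_mul (by rwa [← pow_succ'])
    rw [digitProd_eq_mul_div hp c, mul_assoc, ← ih hc',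
      ← digitProd_add_mul (Nat.mod_lt c hp)]
    congr 1
    conv_lhs => rw [← Nat.mod_add_div c p]
    ring

theorem digitProd_pow_sub_one (hp : 0 < p) (k : ℕ) : digitProd p (p ^ k - 1) = p ^ k := by
  induction k with
  | zero => simp [digitProd_zero]
  | succ k ih =>
    have h : p ^ (k + 1) - 1 = (p - 1) + p * (p ^ k - 1) := by
      have := Nat.pow_pos (n := k) hp
      obtain ⟨c, hc⟩ := Nat.exists_eq_add_of_lt this
      obtain ⟨d, rfl⟩ := Nat.exists_eq_add_of_lt hp
      simp only [zero_add] at hc ⊢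
      rw [pow_succ, hc, Nat.add_sub_cancel, Nat.add_sub_cancel, Nat.sub_eq_iff_eq_add (by nlinarith)]
      ring
    rw [h, digitProd_add_mul (by omega), ih, pow_succ']
    congr 1
    omega

theorem pow_sub_pow_add_eq {k e : ℕ} (c : ℕ) :
    p ^ (k + 1 + e) - p ^ (e + 1) + c * p ^ e = p ^ e * (c + p * (p ^ k - 1)) := by
  have h : p ^ (k + 1 + e) = p ^ e * (p * p ^ k) := by ring
  rw [h, pow_succ p e, Nat.mul_sub, mul_one, mul_add, Nat.mul_sub, add_comm, mul_comm c]

theorem digitProd_pow_sub_pow_add {k e c : ℕ} (hc : c < p) :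
    digitProd p (p ^ (k + 1 + e) - p ^ (e + 1) + c * p ^ e) = (c + 1) * p ^ k := by
  have hp : 0 < p := by omega
  have h := digitProd_add_pow_mul hp e (c := 0) (Nat.pow_pos hp) (c + p * (p ^ k - 1))
  rw [zero_add, digitProd_zero, one_mul] at h
  rw [pow_sub_pow_add_eq, h, digitProd_add_mul hc, digitProd_pow_sub_one hp]

theorem le_digitProd {k e c t : ℕ} (hc : c + 2 ≤ p)
    (hlt : p ^ (k + 1 + e) - p ^ (e + 1) + c * p ^ e < t) (ht : t < p ^ (k + 1 + e)) :
    (c + 2) * p ^ k ≤ digitProd p t := by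
  have hp : 0 < p := by omega
  have hpe : 0 < p ^ e := Nat.pow_pos hp
  rw [pow_sub_pow_add_eq] at hlt
  have hb : t / p ^ e < p ^ (k + 1) := Nat.div_lt_of_lt_mul (by rwa [← pow_add, add_comm])
  have hb1 : c + p * (p ^ k - 1) ≤ t / p ^ e := by
    rw [Nat.le_div_iff_mul_le hpe, mul_comm]
    exact hlt.le
  have hdiv : t / p ^ e / p = p ^ k - 1 := by
    refine le_antisymm (Nat.le_sub_one_of_lt (Nat.div_lt_of_lt_mul (by rwa [← pow_succ']))) ?_
    rw [Nat.le_div_iff_mul_le hp, mul_comm]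
    omega
  have hmod := Nat.mod_add_div (t / p ^ e) p
  rw [hdiv] at hmod
  rw [← Nat.mod_add_div t (p ^ e), digitProd_add_pow_mul hp e (Nat.mod_lt _ hpe),
    digitProd_eq_mul_div hp (t / p ^ e), hdiv, digitProd_pow_sub_one hp, ← mul_assoc]
  refine Nat.mul_le_mul_right _ ?_
  by_cases h : c + 1 ≤ t / p ^ e % p
  · exact le_mul_of_one_le_of_le (digitProd_pos _ _) (by omega)
  · have hc' : t / p ^ e % p = c := by omega
    have hpos : 0 < t % p ^ e := by
      rw [← Nat.mod_add_div t (p ^ e), ← hmod, hc'] at hlt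
      omega
    rw [hc']
    nlinarith [two_le_digitProd (by omega : 1 < p) hpos]

theorem exists_pow_sub_pow_add_lt {s t : ℕ} (hp : 1 < p) (ht : 0 < t) (hts : t < p ^ s) :
    ∃ k e c : ℕ, k + 1 + e = s ∧ c + 2 ≤ p ∧ p ^ s - p ^ (e + 1) + c * p ^ e + 1 ≤ t ∧
      t ≤ p ^ s - p ^ (e + 1) + (c + 1) * p ^ e := by
  set e := Nat.log p (p ^ s - t) with he
  have h1 : p ^ e ≤ p ^ s - t := Nat.pow_log_le_self p (by omega)
  have h2 : p ^ s - t < p ^ (e + 1) := Nat.lt_pow_succ_log_self hp _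
  have hes : e < s := (Nat.pow_lt_pow_iff_right hp).1 (by omega)
  have hpe : 0 < p ^ e := Nat.pow_pos (by omega)
  have hle : p ^ (e + 1) ≤ p ^ s := Nat.pow_le_pow_right (by omega) hes
  set J := t - (p ^ s - p ^ (e + 1)) - 1 with hJ
  have hmod := Nat.mod_add_div J (p ^ e)
  have hmul := Nat.mul_div_le J (p ^ e)
  have hlt := Nat.mod_lt J hpe
  refine ⟨s - 1 - e, e, J / p ^ e, by omega, ?_, ?_, ?_⟩
  · have : J / p ^ e < p - 1 := by
      refine Nat.div_lt_of_lt_mul ?_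
      rw [Nat.mul_sub, mul_one, ← pow_succ]
      omega
    omega
  · rw [mul_comm (J / p ^ e)]
    omega
  · rw [add_mul, one_mul, mul_comm (J / p ^ e)]
    omega

end DigitProd

section Weight

variable {F : Type*} [Field F]

theorem one_le_card_support {f : F[X]} (hf : f ≠ 0) : 1 ≤ f.support.card := by
  rwa [Nat.one_le_iff_ne_zero, Finset.card_ne_zero, support_nonempty]

theorem succ_le_card_support {p : ℕ} [CharP F p] {t : ℕ} {f : F[X]} (hf : f ≠ 0)
    (hlt : ∀ i ∈ f.support, i < p) (hdvd : (X - 1) ^ t ∣ f) : t + 1 ≤ f.support.card := by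
  induction t generalizing f with
  | zero => exact one_le_card_support hf
  | succ t ih =>
    obtain ⟨k, hk⟩ := support_nonempty.2 hf
    set g := X * derivative f - Polynomial.C (k : F) * f with hg
    have hcoeff (i : ℕ) : g.coeff i = ((i : F) - k) * f.coeff i := by
      rw [hg, coeff_sub, coeff_C_mul]
      cases i with
      | zero => simp
      | succ i => rw [coeff_X_mul, coeff_derivative]; push_cast; ring
    have hsupp : g.support ⊆ f.support.erase k := by
      intro i hi
      rw [mem_support_iff, hcoeff] at hi
      rw [Finset.mem_erase, mem_support_iff]
      refine ⟨?_, right_ne_zero_of_mul hi⟩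
      rintro rfl
      simp at hi
    have hg0 : g ≠ 0 := by
      intro h0
      have hz (i : ℕ) (hik : i ≠ k) : f.coeff i = 0 := by
        by_contra hi
        have h := hcoeff i
        rw [h0, coeff_zero, eq_comm, mul_eq_zero, or_iff_left hi, sub_eq_zero] at h
        exact hik (CharP.natCast_injOn_Iio F p (hlt i (mem_support_iff.2 hi)) (hlt k hk) h)
      have hfk : f = monomial k (f.coeff k) := by
        ext i
        rw [coeff_monomial]
        split_ifs with h
        · rw [h]
        · exact hz i (Ne.symm h)
      have hroot : f.eval 1 = 0 := by
        obtain ⟨u, hu⟩ := hdvd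
        simp [hu, pow_succ]
      rw [hfk, eval_monomial, one_pow, mul_one] at hroot
      exact mem_support_iff.1 hk hroot
    have hgd : (X - 1) ^ t ∣ g := by
      refine dvd_sub (dvd_mul_of_dvd_right ?_ _)
        (dvd_mul_of_dvd_right ((pow_dvd_pow _ t.le_succ).trans hdvd) _)
      simpa using pow_sub_one_dvd_derivative_of_pow_dvd hdvd
    have h1 := ih hg0 (fun i hi => hlt i (Finset.mem_of_mem_erase (hsupp hi))) hgd
    have h2 := Finset.card_le_card hsupp
    rw [Finset.card_erase_of_mem hk] at h2
    omega

theorem X_pow_char_pow_sub_one (p k : ℕ) [Fact p.Prime] [CharP F p] :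
    (X ^ p ^ k - 1 : F[X]) = (X - 1) ^ p ^ k := by
  rw [sub_pow_char_pow, one_pow]

theorem X_sub_one_pow_eq (p t : ℕ) [Fact p.Prime] [CharP F p] :
    ((X - 1) ^ t : F[X]) = (X ^ p - 1) ^ (t / p) * (X - 1) ^ (t % p) := by
  have h := X_pow_char_pow_sub_one (F := F) p 1
  rw [pow_one] at h
  rw [h, ← pow_mul, ← pow_add, Nat.div_add_mod]

/-- The weight-retaining property: a polynomial vanishing to order exactly `t` at `1` has at least
as many terms as `(X - 1) ^ t`. -/
theorem digitProd_le_card_support {p : ℕ} [Fact p.Prime] [CharP F p] (t : ℕ) {u : F[X]}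
    (hu : u.eval 1 ≠ 0) : digitProd p t ≤ ((X - 1) ^ t * u).support.card := by
  have hp : p.Prime := Fact.out
  induction t using Nat.strong_induction_on generalizing u with
  | _ t ih =>
    have hX : (X - 1 : F[X]) = X - Polynomial.C 1 := by simp
    have hu0 : u ≠ 0 := by rintro rfl; simp at hu
    rcases Nat.eq_zero_or_pos t with rfl | ht
    · simpa [digitProd_zero] using one_le_card_support hu0
    have hpow := X_pow_char_pow_sub_one (F := F) p 1
    rw [pow_one] at hpow
    set g := (X - 1) ^ (t % p) * u with hg
    rw [digitProd_eq_mul_div hp.pos, X_sub_one_pow_eq p, mul_assoc, mul_comm]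
    refine le_trans (Nat.mul_le_mul_left _ ?_) (mul_card_support_modByMonic_le hp.pos
      (fun u hu => ih _ (Nat.div_lt_self ht hp.one_lt) hu) g)
    have hmod := Nat.mod_lt t hp.pos
    refine succ_le_card_support (p := p) ?_ ?_ ?_
    · rw [Ne, modByMonic_eq_zero_iff_dvd (monic_X_pow_sub_one hp.pos), hpow]
      intro h
      have h2 := (pow_dvd_pow (X - 1 : F[X]) (Nat.succ_le_of_lt hmod)).trans h
      rw [hg, pow_succ, mul_dvd_mul_iff_left (pow_ne_zero _ (by
        rw [hX]; exact X_sub_C_ne_zero 1)), hX, dvd_iff_isRoot] at h2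
      exact hu h2
    · intro i hi
      by_contra! h
      exact mem_support_iff.1 hi (coeff_eq_zero_of_degree_lt
        ((degree_modByMonic_X_pow_sub_one_lt hp.pos g).trans_le (by exact_mod_cast h)))
    · rw [modByMonic_eq_sub_mul_div]
      refine dvd_sub (dvd_mul_right _ _) (dvd_mul_of_dvd_left ?_ _)
      rw [hpow]
      exact pow_dvd_pow _ hmod.le

theorem card_support_X_sub_one_pow_le (p t : ℕ) [Fact p.Prime] [CharP F p] :
    ((X - 1) ^ t : F[X]).support.card ≤ digitProd p t := by
  have hp : p.Prime := Fact.out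
  induction t using Nat.strong_induction_on with
  | _ t ih =>
    rcases Nat.eq_zero_or_pos t with rfl | ht
    · simpa [digitProd_zero] using card_supp_le_succ_natDegree (1 : F[X])
    have hexp : ((X ^ p - 1) ^ (t / p) : F[X]) = expand F p ((X - 1) ^ (t / p)) := by simp
    rw [X_sub_one_pow_eq p, hexp, digitProd_eq_mul_div hp.pos, mul_comm (t % p + 1)]
    refine card_support_mul_le.trans (Nat.mul_le_mul
      ((card_support_expand_le hp.pos _).trans (ih _ (Nat.div_lt_self ht hp.one_lt))) ?_)
    refine (card_supp_le_succ_natDegree _).trans ?_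
    have hX : (X - 1 : F[X]) = X - Polynomial.C 1 := by simp
    rw [hX, natDegree_pow, natDegree_X_sub_C, mul_one]

theorem card_support_X_pow_sub_one_pow_le (p t : ℕ) [Fact p.Prime] [CharP F p] {n : ℕ}
    (hn : 0 < n) : ((X ^ n - 1) ^ t : F[X]).support.card ≤ digitProd p t := by
  have hexp : ((X ^ n - 1) ^ t : F[X]) = expand F n ((X - 1) ^ t) := by simp
  rw [hexp]
  exact (card_support_expand_le hn _).trans (card_support_X_sub_one_pow_le p t)

theorem card_support_pow_char_pow_le (p s : ℕ) [Fact p.Prime] [CharP F p] (c : F[X]) :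
    (c ^ p ^ s).support.card ≤ c.support.card := by
  have hp : p.Prime := Fact.out
  have : ExpChar F p := ExpChar.prime hp
  rw [← map_iterateFrobenius_expand p c s]
  exact (Finset.card_le_card (support_map_subset _ _)).trans
    (card_support_expand_le (pow_pos hp.pos s) c)

end Weight

section Distance

variable {F : Type*} [Field F] {n : ℕ}

theorem coeffRepr_mk {f : F[X]} (hf : f ≠ 0) (hm : f.Monic) (g : F[X])
    (i : Fin (AdjoinRoot.powerBasis hf).dim) :
    coeffRepr hf (AdjoinRoot.mk f g) i = (g %ₘ f).coeff i := by
  have hmk : AdjoinRoot.mk f g = AdjoinRoot.mk f (g %ₘ f) := by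
    rw [AdjoinRoot.mk_eq_mk, modByMonic_eq_sub_mul_div]
    simp
  have hsum : AdjoinRoot.mk f g = ∑ k : Fin (AdjoinRoot.powerBasis hf).dim,
      (g %ₘ f).coeff k • (AdjoinRoot.powerBasis hf).basis k := by
    rw [hmk, ← sum_modByMonic_coeff hm (n := (AdjoinRoot.powerBasis hf).dim)
      (by rw [AdjoinRoot.powerBasis_dim]; exact degree_le_natDegree), map_sum,
      sum_modByMonic_coeff hm (by rw [AdjoinRoot.powerBasis_dim]; exact degree_le_natDegree)]
    refine Finset.sum_congr rfl fun k _ => ?_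
    rw [PowerBasis.coe_basis, AdjoinRoot.powerBasis_gen, ← C_mul_X_pow_eq_monomial, map_mul,
      map_pow, AdjoinRoot.mk_X, AdjoinRoot.mk_C, Algebra.smul_def, AdjoinRoot.algebraMap_eq]
  rw [coeffRepr, hsum, Module.Basis.repr_sum_self]

theorem hammingWeight_mk (hn : 0 < n) (hf : (X ^ n - 1 : F[X]) ≠ 0) (g : F[X]) :
    hammingWeight hf (AdjoinRoot.mk _ g) = (g %ₘ (X ^ n - 1)).support.card := by
  have hdim : (AdjoinRoot.powerBasis hf).dim = n := by
    rw [AdjoinRoot.powerBasis_dim, natDegree_X_pow_sub_one]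
  rw [hammingWeight, ← Finset.card_map Fin.valEmbedding]
  congr 1
  ext k
  simp only [Finset.mem_map, Finset.mem_filter, Finset.mem_univ, true_and, mem_support_iff,
    Fin.valEmbedding_apply, coeffRepr_mk hf (monic_X_pow_sub_one hn)]
  constructor
  · rintro ⟨i, hi, rfl⟩
    exact hi
  · intro hk
    refine ⟨⟨k, ?_⟩, hk, rfl⟩
    rw [hdim]
    by_contra! h
    exact hk (coeff_eq_zero_of_degree_lt
      ((degree_modByMonic_X_pow_sub_one_lt hn g).trans_le (by exact_mod_cast h)))

theorem dHamming_span_le (hn : 0 < n) (hf : (X ^ n - 1 : F[X]) ≠ 0) {G g : F[X]} (hG : G ∣ g)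
    (hg : ¬ (X ^ n - 1) ∣ g) :
    dHamming hf (Ideal.span {AdjoinRoot.mk _ G}) ≤ g.support.card := by
  refine le_trans (Nat.sInf_le ⟨AdjoinRoot.mk _ g, ?_, ?_, rfl⟩)
    ((hammingWeight_mk hn hf g).trans_le (card_support_modByMonic_le hn g))
  · exact Ideal.mem_span_singleton.2 (map_dvd _ hG)
  · rwa [Ne, AdjoinRoot.mk_eq_zero]

theorem exists_card_support_eq_dHamming_span (hn : 0 < n) (hf : (X ^ n - 1 : F[X]) ≠ 0) {G : F[X]}
    (hG : G ∣ X ^ n - 1) (hG0 : ¬ (X ^ n - 1) ∣ G) :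
    ∃ g : F[X], G ∣ g ∧ ¬ (X ^ n - 1) ∣ g ∧
      dHamming hf (Ideal.span {AdjoinRoot.mk _ G}) = g.support.card := by
  obtain ⟨x, hx, hx0, hw⟩ := Nat.sInf_mem (s := {w | ∃ x ∈
      Ideal.span {AdjoinRoot.mk (X ^ n - 1 : F[X]) G}, x ≠ 0 ∧ w = hammingWeight hf x})
    ⟨_, AdjoinRoot.mk _ G, Ideal.mem_span_singleton_self _, by rwa [Ne, AdjoinRoot.mk_eq_zero], rfl⟩
  rw [Ideal.mem_span_singleton] at hx
  obtain ⟨y, rfl⟩ := hx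
  obtain ⟨u, rfl⟩ := AdjoinRoot.mk_surjective y
  rw [← map_mul] at hx0 hw
  rw [hammingWeight_mk hn] at hw
  rw [Ne, AdjoinRoot.mk_eq_zero] at hx0
  refine ⟨(G * u) %ₘ (X ^ n - 1), ?_, ?_, hw⟩
  · rw [modByMonic_eq_sub_mul_div]
    exact dvd_sub (dvd_mul_right _ _) (dvd_mul_of_dvd_left hG _)
  · rwa [modByMonic_eq_sub_mul_div, dvd_sub_left (dvd_mul_right _ _)]

end Distance

section RepeatedRoot

variable {F : Type*} [Field F] {ι : Type*} [Fintype ι] {ρ : ι → F}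

theorem prod_X_sub_C_pow_dvd (hρ : Function.Injective ρ) {e : ι → ℕ} {g : F[X]}
    (h : ∀ i, (X - Polynomial.C (ρ i)) ^ e i ∣ g) :
    ∏ i, (X - Polynomial.C (ρ i)) ^ e i ∣ g :=
  Finset.prod_dvd_of_coprime
    (fun _ _ _ _ hij => (pairwise_coprime_X_sub_C hρ hij).pow) fun i _ => h i

theorem isCoprime_X_sub_C_prod_erase (hρ : Function.Injective ρ) (e : ι → ℕ) (i : ι) :
    IsCoprime (X - Polynomial.C (ρ i))
      (∏ k ∈ Finset.univ.erase i, (X - Polynomial.C (ρ k)) ^ e k) :=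
  IsCoprime.prod_right fun _ hk =>
    (pairwise_coprime_X_sub_C hρ (Finset.ne_of_mem_erase hk).symm).pow_right

theorem not_X_sub_C_pow_dvd_prod (hρ : Function.Injective ρ) {e : ι → ℕ} {i : ι} {k : ℕ}
    (hk : e i < k) :
    ¬ (X - Polynomial.C (ρ i)) ^ k ∣ ∏ l, (X - Polynomial.C (ρ l)) ^ e l := by
  intro h
  rw [← Finset.mul_prod_erase _ _ (Finset.mem_univ i)] at h
  have h1 := (pow_dvd_pow (X - Polynomial.C (ρ i)) (Nat.succ_le_of_lt hk)).trans h
  rw [pow_succ, mul_dvd_mul_iff_left (pow_ne_zero _ (X_sub_C_ne_zero _))] at h1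
  exact not_isUnit_X_sub_C _ ((isCoprime_X_sub_C_prod_erase hρ e i).isUnit_of_dvd' dvd_rfl h1)

variable {n p s : ℕ}

theorem X_sub_C_dvd_X_pow_sub_one (hprod : ∏ i, (X - Polynomial.C (ρ i)) = X ^ n - 1) (i : ι) :
    X - Polynomial.C (ρ i) ∣ X ^ n - 1 :=
  hprod ▸ Finset.dvd_prod_of_mem _ (Finset.mem_univ i)

variable [Fact p.Prime] [CharP F p]

theorem X_pow_mul_char_pow_sub_one (p n s : ℕ) [Fact p.Prime] [CharP F p] :
    (X ^ (n * p ^ s) - 1 : F[X]) = (X ^ n - 1) ^ p ^ s := by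
  rw [sub_pow_char_pow, one_pow, pow_mul]

theorem prod_X_sub_C_pow_dvd_X_pow_sub_one (hρ : Function.Injective ρ)
    (hprod : ∏ i, (X - Polynomial.C (ρ i)) = X ^ n - 1) {e : ι → ℕ} (he : ∀ i, e i ≤ p ^ s) :
    ∏ i, (X - Polynomial.C (ρ i)) ^ e i ∣ X ^ (n * p ^ s) - 1 := by
  rw [X_pow_mul_char_pow_sub_one]
  exact prod_X_sub_C_pow_dvd hρ fun i =>
    (pow_dvd_pow _ (he i)).trans (pow_dvd_pow_of_dvd (X_sub_C_dvd_X_pow_sub_one hprod i) _)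

/-- A polynomial of `C_t` with `t < p ^ s` yields a codeword of the repeated-root code whose weight
is at most `digitProd p t` times larger. -/
theorem dHamming_le_digitProd_mul (hn : 0 < n) (hρ : Function.Injective ρ)
    (hprod : ∏ i, (X - Polynomial.C (ρ i)) = X ^ n - 1) (hf : (X ^ (n * p ^ s) - 1 : F[X]) ≠ 0)
    {e : ι → ℕ} (he : ∀ i, e i ≤ p ^ s) {t : ℕ} (ht : t < p ^ s) {c : F[X]}
    (hc : ¬ (X ^ n - 1) ∣ c) (hdvd : ∀ i, t < e i → X - Polynomial.C (ρ i) ∣ c) :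
    dHamming hf (Ideal.span {AdjoinRoot.mk _ (∏ i, (X - Polynomial.C (ρ i)) ^ e i)}) ≤
      digitProd p t * c.support.card := by
  have hp : p.Prime := Fact.out
  refine le_trans (dHamming_span_le (mul_pos hn (pow_pos hp.pos s)) hf
    (g := (X ^ n - 1) ^ t * c ^ p ^ s) (prod_X_sub_C_pow_dvd hρ fun i => ?_) fun h => hc ?_) ?_
  · by_cases hi : t < e i
    · exact dvd_mul_of_dvd_right ((pow_dvd_pow _ (he i)).trans (pow_dvd_pow_of_dvd (hdvd i hi) _)) _
    · exact dvd_mul_of_dvd_left ((pow_dvd_pow _ (not_lt.1 hi)).trans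
        (pow_dvd_pow_of_dvd (X_sub_C_dvd_X_pow_sub_one hprod i) _)) _
  · rw [X_pow_mul_char_pow_sub_one] at h
    have h1 := (pow_dvd_pow (X ^ n - 1 : F[X]) (Nat.succ_le_of_lt ht)).trans h
    rw [pow_succ, mul_dvd_mul_iff_left (pow_ne_zero _ (monic_X_pow_sub_one hn).ne_zero)] at h1
    rw [← hprod]
    have h2 := prod_X_sub_C_pow_dvd hρ (e := fun _ => 1) (g := c) fun i => by
      rw [pow_one]
      exact (prime_X_sub_C _).dvd_of_dvd_pow ((X_sub_C_dvd_X_pow_sub_one hprod i).trans h1)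
    simpa using h2
  · exact card_support_mul_le.trans (Nat.mul_le_mul (card_support_X_pow_sub_one_pow_le p t hn)
      (card_support_pow_char_pow_le p s c))

/-- A codeword of the repeated-root code yields, for some `t < p ^ s`, a codeword of `C_t` whose
weight is at least `digitProd p t` times smaller. -/
theorem exists_digitProd_mul_card_support_le (hn : 0 < n) (hρ : Function.Injective ρ)
    (hprod : ∏ i, (X - Polynomial.C (ρ i)) = X ^ n - 1) {e : ι → ℕ} {f : F[X]}
    (hf : ¬ (X ^ (n * p ^ s) - 1) ∣ f) (hdvd : ∏ i, (X - Polynomial.C (ρ i)) ^ e i ∣ f) :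
    ∃ t < p ^ s, ∃ g : F[X], ¬ (X ^ n - 1) ∣ g ∧
      (∀ i, t < e i → X - Polynomial.C (ρ i) ∣ g) ∧
      digitProd p t * g.support.card ≤ f.support.card := by
  rw [X_pow_mul_char_pow_sub_one] at hf
  have hex : ∃ k, ¬ (X ^ n - 1 : F[X]) ^ k ∣ f := ⟨_, hf⟩
  obtain ⟨t, ht⟩ : ∃ t, Nat.find hex = t + 1 :=
    Nat.exists_eq_succ_of_ne_zero fun h0 => by simpa [h0] using Nat.find_spec hex
  have hndvd : ¬ (X ^ n - 1 : F[X]) ^ (t + 1) ∣ f := ht ▸ Nat.find_spec hex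
  obtain ⟨g, rfl⟩ : (X ^ n - 1 : F[X]) ^ t ∣ f :=
    not_not.1 (Nat.find_min hex (m := t) (by omega))
  rw [pow_succ, mul_dvd_mul_iff_left (pow_ne_zero _ (monic_X_pow_sub_one hn).ne_zero)] at hndvd
  have htlt : t < p ^ s := by
    have := Nat.find_min' hex hf
    omega
  refine ⟨t, htlt, g %ₘ (X ^ n - 1), ?_, fun i hi => ?_,
    mul_card_support_modByMonic_le hn (fun u hu => digitProd_le_card_support t hu) g⟩
  · rwa [modByMonic_eq_sub_mul_div, dvd_sub_left (dvd_mul_right _ _)]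
  · rw [modByMonic_eq_sub_mul_div]
    refine dvd_sub ?_ (dvd_mul_of_dvd_left (X_sub_C_dvd_X_pow_sub_one hprod i) _)
    have h1 : (X - Polynomial.C (ρ i)) ^ (t + 1) ∣ (X ^ n - 1) ^ t * g :=
      ((pow_dvd_pow _ hi).trans (Finset.dvd_prod_of_mem
        (fun k => (X - Polynomial.C (ρ k)) ^ e k) (Finset.mem_univ i))).trans hdvd
    rw [← hprod, ← Finset.mul_prod_erase _ _ (Finset.mem_univ i), mul_pow, mul_assoc, pow_succ,
      mul_dvd_mul_iff_left (pow_ne_zero _ (X_sub_C_ne_zero _))] at h1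
    have hcop := isCoprime_X_sub_C_prod_erase hρ (fun _ => 1) i
    simp only [pow_one] at hcop
    exact hcop.pow_right.dvd_of_dvd_mul_left h1

end RepeatedRoot

theorem prod_X_sub_C_primitiveRoot_perm {F : Type*} [Field F] {n : ℕ} (hn : 0 < n) {θ : F}
    (hθ : IsPrimitiveRoot θ n) (σ : Equiv.Perm (Fin n)) :
    Function.Injective (fun h => θ ^ (σ h : ℕ)) ∧
      ∏ h, (X - Polynomial.C (θ ^ (σ h : ℕ))) = X ^ n - 1 := by
  have hinj : Function.Injective (fun h => θ ^ (σ h : ℕ)) := fun h h' heq =>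
    σ.injective (Fin.ext (hθ.pow_inj (σ h).2 (σ h').2 heq))
  refine ⟨hinj, (eq_of_monic_of_dvd_of_natDegree_le
    (monic_prod_of_monic _ _ fun h _ => monic_X_sub_C _) (monic_X_pow_sub_one hn) ?_ ?_).symm⟩
  · have h := prod_X_sub_C_pow_dvd hinj (e := fun _ => 1) (g := X ^ n - 1) fun h => by
      rw [pow_one, dvd_iff_isRoot, IsRoot]
      simp [← pow_mul, mul_comm _ n, pow_mul θ n, hθ.pow_eq_one]
    simpa only [pow_one] using h
  · rw [natDegree_X_pow_sub_one, natDegree_prod_of_monic _ _ fun h _ => monic_X_sub_C _]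
    simp only [natDegree_X_sub_C, Finset.sum_const, Finset.card_univ, Fintype.card_fin,
      smul_eq_mul, mul_one, le_refl]

end RepeatedRootCode

/-- for `q = p^m = 2^a·b+1` with `a ≥ r ≥ 1`, `θ ∈ F_q` a primitive
`2^r`-th root of unity, `(i_h) = (σ h)` a permutation of `0,…,2^r−1` and
`p^s ≥ j_0 ≥ … ≥ j_{2^r−1} ≥ 0` not all equal to `p^s`, the cyclic code
`C = ⟨∏_h (x − θ^{i_h})^{j_h}⟩ ⊆ F_q[x]/(x^{2^r p^s} − 1)` satisfies:
(1) if `j_{2^r−1} = 0` then `d_H(C) ≤ 2^r`;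
(2) if `j_{2^r−1} > 0` then `d_H(C) = min{(τ_h+2)·p^{k_h}·d_H(C_{t_h}) : N₀ ≤ h ≤ 2^r−1}`,
where `k_h, τ_h` are the unique integers with
`p^s − p^{s−k_h} + τ_h p^{s−k_h−1} + 1 ≤ j_h ≤ p^s − p^{s−k_h} + (τ_h+1) p^{s−k_h−1}`,
`t_h = p^s − p^{s−k_h} + (τ_h+1) p^{s−k_h−1}`, and `C_t = ⟨∏_h (x − θ^{i_h})^{e_{h,t}}⟩`
with `e_{h,t} = 1` iff `j_h > t`. -/
theorem stmt14 (p m a b r s : ℕ) (hp : p.Prime) (hpodd : Odd p) (hm : 0 < m) (hs : 0 < s)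
    (hb : Odd b) (hr : 1 ≤ r) (hra : r ≤ a) (hq : p ^ m = 2 ^ a * b + 1)
    (F : Type*) [Field F] [Fintype F] (hF : Fintype.card F = p ^ m)
    (θ : F) (hθ : IsPrimitiveRoot θ (2 ^ r))
    (σ : Equiv.Perm (Fin (2 ^ r)))
    (j : Fin (2 ^ r) → ℕ) (hj : ∀ h, j h ≤ p ^ s)
    (hanti : ∀ h h' : Fin (2 ^ r), h ≤ h' → j h' ≤ j h)
    (hnotall : ¬∀ h, j h = p ^ s)
    (N : ℕ) (hN : N = 2 ^ r * p ^ s)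
    (hf : (X ^ N - 1 : Polynomial F) ≠ 0)
    (hf2 : (X ^ 2 ^ r - 1 : Polynomial F) ≠ 0)
    (C : Ideal (AdjoinRoot (X ^ N - 1 : Polynomial F)))
    (hC : C = Ideal.span {AdjoinRoot.mk (X ^ N - 1 : Polynomial F)
      (∏ h : Fin (2 ^ r), (X - Polynomial.C (θ ^ (σ h : ℕ))) ^ j h)})
    (N₀ : ℕ) (hN₀ : N₀ = (Finset.univ.filter fun h : Fin (2 ^ r) => j h = p ^ s).card) :
    (j (lastIdx r) = 0 → dHamming hf C ≤ 2 ^ r) ∧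
    (0 < j (lastIdx r) → dHamming hf C =
      sInf {d : ℕ | ∃ h : Fin (2 ^ r), N₀ ≤ (h : ℕ) ∧ ∃ k τ : ℕ,
        k ≤ s - 1 ∧ τ ≤ p - 2 ∧
        p ^ s - p ^ (s - k) + τ * p ^ (s - k - 1) + 1 ≤ j h ∧
        j h ≤ p ^ s - p ^ (s - k) + (τ + 1) * p ^ (s - k - 1) ∧
        d = (τ + 2) * p ^ k * dHamming hf2 (Ideal.span {AdjoinRoot.mk
          (X ^ 2 ^ r - 1 : Polynomial F)
          (∏ h' : Fin (2 ^ r), (X - Polynomial.C (θ ^ (σ h' : ℕ))) ^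
            (if p ^ s - p ^ (s - k) + (τ + 1) * p ^ (s - k - 1) < j h' then 1 else 0))})}) := by
  have : Fact p.Prime := ⟨hp⟩
  have : CharP F p := charP_of_card_eq_prime_pow hF
  have hn : 0 < 2 ^ r := Nat.two_pow_pos r
  subst hN hC hN₀
  obtain ⟨hρ, hprod⟩ := RepeatedRootCode.prod_X_sub_C_primitiveRoot_perm hn hθ σ
  have hlast : ∀ h, j (lastIdx r) ≤ j h := fun h =>
    hanti h (lastIdx r) (Nat.le_sub_one_of_lt h.2)
  have hlt : j (lastIdx r) < p ^ s :=
    (hj _).lt_of_ne fun h => hnotall fun h' => le_antisymm (hj h') (h ▸ hlast h')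
  have hnot {e : Fin (2 ^ r) → ℕ} {h : Fin (2 ^ r)} (he : e h = 0) :
      ¬ (X ^ 2 ^ r - 1) ∣ ∏ h, (X - Polynomial.C (θ ^ (σ h : ℕ))) ^ e h := fun hd =>
    RepeatedRootCode.not_X_sub_C_pow_dvd_prod hρ (e := e) (i := h) (k := 1) (by omega)
      (by simpa using (RepeatedRootCode.X_sub_C_dvd_X_pow_sub_one hprod h).trans hd)
  have hcode (t : ℕ) (h : Fin (2 ^ r)) (ht : t < j h) : X - Polynomial.C (θ ^ (σ h : ℕ)) ∣
      ∏ h', (X - Polynomial.C (θ ^ (σ h' : ℕ))) ^ (if t < j h' then 1 else 0) := by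
    have := Finset.dvd_prod_of_mem (fun h' => (X - Polynomial.C (θ ^ (σ h' : ℕ))) ^
      (if t < j h' then 1 else 0)) (Finset.mem_univ h)
    simpa [ht] using this
  refine ⟨fun h0 => ?_, fun h0 => ?_⟩
  · have hc := hnot (e := fun h => if 0 < j h then 1 else 0) (h := lastIdx r) (by simp [h0])
    refine (RepeatedRootCode.dHamming_le_digitProd_mul hn hρ hprod hf hj (t := 0) (by omega)
      (c := (∏ h, (X - Polynomial.C (θ ^ (σ h : ℕ))) ^ (if 0 < j h then 1 else 0)) %ₘ
        (X ^ 2 ^ r - 1)) ?_ ?_).trans ?_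
    · rwa [modByMonic_eq_sub_mul_div, dvd_sub_left (dvd_mul_right _ _)]
    · intro h hh
      rw [modByMonic_eq_sub_mul_div]
      exact dvd_sub (hcode 0 h hh)
        (dvd_mul_of_dvd_left (RepeatedRootCode.X_sub_C_dvd_X_pow_sub_one hprod h) _)
    · rw [RepeatedRootCode.digitProd_zero, one_mul]
      refine (card_supp_le_succ_natDegree _).trans ?_
      exact (RepeatedRootCode.degree_lt_iff_natDegree_lt_of_pos hn).1
        (RepeatedRootCode.degree_modByMonic_X_pow_sub_one_lt hn _)
  set S := {d : ℕ | ∃ h : Fin (2 ^ r), _ ≤ (h : ℕ) ∧ ∃ k τ : ℕ, _}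
  have hlower : ∀ d ∈ S, dHamming hf (Ideal.span {AdjoinRoot.mk _
      (∏ h : Fin (2 ^ r), (X - Polynomial.C (θ ^ (σ h : ℕ))) ^ j h)}) ≤ d := by
    rintro d ⟨h, -, k, τ, hk, hτ, -, hle, rfl⟩
    have hp2 := hp.two_le
    obtain ⟨e, rfl⟩ : ∃ e, s = k + 1 + e := ⟨s - k - 1, by omega⟩
    rw [show k + 1 + e - k - 1 = e by omega, show k + 1 + e - k = e + 1 by omega] at *
    set t := p ^ (k + 1 + e) - p ^ (e + 1) + (τ + 1) * p ^ e with ht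
    have htlt : t < p ^ (k + 1 + e) := by
      have h1 : p ^ (e + 1) ≤ p ^ (k + 1 + e) := Nat.pow_le_pow_right hp.pos (by omega)
      have h2 : (τ + 1) * p ^ e < p * p ^ e :=
        Nat.mul_lt_mul_of_pos_right (by omega) (pow_pos hp.pos e)
      rw [← pow_succ'] at h2
      omega
    obtain ⟨g, hg, hg0, hgw⟩ := RepeatedRootCode.exists_card_support_eq_dHamming_span hn hf2
      (G := ∏ h' : Fin (2 ^ r), (X - Polynomial.C (θ ^ (σ h' : ℕ))) ^ (if t < j h' then 1 else 0))
      (RepeatedRootCode.prod_X_sub_C_pow_dvd hρ fun h' => by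
        split_ifs
        · simpa using RepeatedRootCode.X_sub_C_dvd_X_pow_sub_one hprod h'
        · simp) (hnot (h := h) (by simp [hle]))
    rw [hgw, ← RepeatedRootCode.digitProd_pow_sub_pow_add (e := e) (by omega : τ + 1 < p)]
    exact RepeatedRootCode.dHamming_le_digitProd_mul hn hρ hprod hf hj htlt hg0
      fun h' hh' => (hcode t h' hh').trans hg
  obtain ⟨d, hdS, hd⟩ : ∃ d ∈ S, d ≤ dHamming hf (Ideal.span {AdjoinRoot.mk _
      (∏ h : Fin (2 ^ r), (X - Polynomial.C (θ ^ (σ h : ℕ))) ^ j h)}) := by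
    obtain ⟨f, hGf, hf0, hw⟩ := RepeatedRootCode.exists_card_support_eq_dHamming_span
      (mul_pos hn (pow_pos hp.pos s)) hf
      (RepeatedRootCode.prod_X_sub_C_pow_dvd_X_pow_sub_one hρ hprod hj) fun hd => by
        rw [RepeatedRootCode.X_pow_mul_char_pow_sub_one] at hd
        exact RepeatedRootCode.not_X_sub_C_pow_dvd_prod hρ hlt ((pow_dvd_pow_of_dvd
          (RepeatedRootCode.X_sub_C_dvd_X_pow_sub_one hprod _) _).trans hd)
    obtain ⟨t, ht, g, hg0, hg, hle⟩ :=
      RepeatedRootCode.exists_digitProd_mul_card_support_le hn hρ hprod hf0 hGf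
    have hne : (Finset.univ.filter fun h => j h ≤ t).Nonempty := by
      by_contra hempty
      rw [Finset.not_nonempty_iff_eq_empty, Finset.filter_eq_empty_iff] at hempty
      refine hg0 (hprod ▸ ?_)
      have := RepeatedRootCode.prod_X_sub_C_pow_dvd hρ (e := fun _ => 1) (g := g) fun h => by
        simpa using hg h (not_le.1 (hempty (Finset.mem_univ h)))
      simpa using this
    obtain ⟨h, hh, hmax⟩ := Finset.exists_max_image _ j hne
    simp only [Finset.mem_filter, Finset.mem_univ, true_and] at hh hmax
    obtain ⟨k, e, τ, hs', hτ, h1, h2⟩ := RepeatedRootCode.exists_pow_sub_pow_add_lt hp.one_lt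
      (h0.trans_le (hlast h)) (hh.trans_lt ht)
    have hk1 : s - k = e + 1 := by omega
    have hk2 : s - k - 1 = e := by omega
    refine ⟨_, ⟨h, ?_, k, τ, by omega, by omega, by rwa [hk1, Nat.add_sub_cancel],
      by rwa [hk1, Nat.add_sub_cancel], rfl⟩, ?_⟩
    · have hsub : (Finset.univ.filter fun h' => j h' = p ^ s) ⊆ Finset.Iio h := by
        intro h' hh'
        rw [Finset.mem_filter] at hh'
        rw [Finset.mem_Iio]
        by_contra! hle'
        have := hanti h h' hle'
        omega
      simpa using Finset.card_le_card hsub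
    · rw [hw]
      refine le_trans (Nat.mul_le_mul ?_ (RepeatedRootCode.dHamming_span_le hn hf2 ?_ hg0)) hle
      · subst hs'
        exact RepeatedRootCode.le_digitProd hτ (by omega) ht
      · refine RepeatedRootCode.prod_X_sub_C_pow_dvd hρ fun h' => ?_
        split_ifs with hlt'
        · rw [hk1, Nat.add_sub_cancel] at hlt'
          rw [pow_one]
          refine hg h' (not_le.1 fun hle' => ?_)
          have := hmax h' hle'
          omega
        · simp
  exact le_antisymm (hlower _ (Nat.sInf_mem ⟨d, hdS⟩)) ((Nat.sInf_le hdS).trans hd)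
end
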